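/- arXiv:1006.2516 — 2 statements merged into one kernel-verified Lean document; each statement's English description precedes it below -/
import Mathlib

section
/- Let V be a grading-restricted vertex algebra and W a grading-restricted generalized V-module. For any v₁,…,vₙ ∈ V, w ∈ W and w′ ∈ W′, the series ⟨w′, Y_W(v₁,z₁)⋯Y_W(vₙ,zₙ)w⟩ converges absolutely in the region |z₁| > ⋯ > |zₙ| > 0 to a rational function R(⟨w′, Y_W(v₁,z₁)⋯Y_W(vₙ,zₙ)w⟩) in z₁,…,zₙ whose only possible poles are at zᵢ = zⱼ (i ≠ j) and zᵢ = 0; moreover, for every permutation σ ∈ Sₙ, R(⟨w′, Y_W(v₁,z₁)⋯Y_W(vₙ,zₙ)w⟩) = R(⟨w′, Y_W(v_{σ(1)},z_{σ(1)})⋯Y_W(v_{σ(n)},z_{σ(n)})w⟩). -/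
open scoped BigOperators Classical

noncomputable section VertexCohomology

/-! ## Rational functions with prescribed poles -/

/-- A function of `n` complex variables (restricted to the configuration space of
pairwise distinct points) which is a rational function with the only possible poles
on the diagonals `z i = z j`, `i ≠ j`. -/
def RatDiag (n : ℕ) (f : (Fin n → ℂ) → ℂ) : Prop :=
  ∃ (P : MvPolynomial (Fin n) ℂ) (N : ℕ),
    ∀ z : Fin n → ℂ, (∀ i j : Fin n, i ≠ j → z i ≠ z j) →
      f z * ∏ i : Fin n, ∏ j : Fin n, (if i < j then (z i - z j) ^ N else 1)
        = MvPolynomial.eval z P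

/-- A rational function of `n` variables with the only possible poles at
`z i = z j` (`i ≠ j`) and `z i = 0`. -/
def RatFull (n : ℕ) (f : (Fin n → ℂ) → ℂ) : Prop :=
  ∃ (P : MvPolynomial (Fin n) ℂ) (N : ℕ),
    ∀ z : Fin n → ℂ, (∀ i, z i ≠ 0) → (∀ i j : Fin n, i ≠ j → z i ≠ z j) →
      f z * ((∏ i : Fin n, z i ^ N) *
        ∏ i : Fin n, ∏ j : Fin n, (if i < j then (z i - z j) ^ N else 1))
        = MvPolynomial.eval z P

/-- A rational function of `n` variables with the only possible poles at
`z i = z j` (`i ≠ j`), the pole at `z i = z j` being of order at most `Nb i j`. -/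
def RatDiagBnd (n : ℕ) (Nb : Fin n → Fin n → ℕ) (f : (Fin n → ℂ) → ℂ) : Prop :=
  ∃ P : MvPolynomial (Fin n) ℂ,
    ∀ z : Fin n → ℂ, (∀ i j : Fin n, i ≠ j → z i ≠ z j) →
      f z * ∏ i : Fin n, ∏ j : Fin n, (if i < j then (z i - z j) ^ (Nb i j) else 1)
        = MvPolynomial.eval z P

/-- A rational function of one variable with the only possible pole at `0`. -/
def RatOne (f : ℂ → ℂ) : Prop :=
  ∃ (P : Polynomial ℂ) (N : ℕ), ∀ z : ℂ, z ≠ 0 → f z * z ^ N = Polynomial.eval z P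

/-! ## Graded duals -/

/-- A linear functional on a `ℤ`-graded space belonging to the graded (restricted) dual:
it is nonzero on only finitely many homogeneous subspaces. -/
def GradedFunctionalZ {V : Type} [AddCommGroup V] [Module ℂ V]
    (grading : ℤ → Submodule ℂ V) (f : V →ₗ[ℂ] ℂ) : Prop :=
  {k : ℤ | ∃ v ∈ grading k, f v ≠ 0}.Finite

/-- A linear functional on a `ℂ`-graded space belonging to the graded (restricted) dual. -/
def GradedFunctionalC {W : Type} [AddCommGroup W] [Module ℂ W]
    (grading : ℂ → Submodule ℂ W) (f : W →ₗ[ℂ] ℂ) : Prop :=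
  {c : ℂ | ∃ w ∈ grading c, f w ≠ 0}.Finite

/-! ## Grading-restricted vertex algebras and modules -/

variable (V : Type) [AddCommGroup V] [Module ℂ V]
variable (W : Type) [AddCommGroup W] [Module ℂ W]

/-- A grading-restricted vertex algebra structure on `V`, with the duality property
(for products and iterates of two vertex operators) as the main axiom.
`Y u v k` denotes the coefficient `(Y_V)_k(u)v` of `x^{-k-1}` in `Y_V(u,x)v`. -/
structure GRVA where
  grading : ℤ → Submodule ℂ V
  decomp : DirectSum.Decomposition grading
  finiteDim : ∀ k : ℤ, Module.Finite ℂ (grading k)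
  lower_bounded : ∃ N : ℤ, ∀ k : ℤ, k < N → grading k = ⊥
  Y : V →ₗ[ℂ] V →ₗ[ℂ] (ℤ → V)
  vacuum : V
  vacuum_mem : vacuum ∈ grading 0
  trunc : ∀ u v : V, ∃ N : ℤ, ∀ k : ℤ, N ≤ k → Y u v k = 0
  identity : ∀ (v : V) (k : ℤ), Y vacuum v k = if k = -1 then v else 0
  creation : ∀ (u : V) (k : ℤ), 0 ≤ k → Y u vacuum k = 0
  creation_lim : ∀ u : V, Y u vacuum (-1) = u
  L0 : Module.End ℂ V
  L0_eq : ∀ (k : ℤ) (v : V), v ∈ grading k → L0 v = (k : ℂ) • v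
  Lm1 : Module.End ℂ V
  Lm1_eq : ∀ v : V, Lm1 v = Y v vacuum (-2)
  L0_bracket : ∀ (u v : V) (k : ℤ), L0 (Y u v k)
      = Y (L0 u) v k + Y u (L0 v) k + ((-k - 1 : ℤ) : ℂ) • Y u v k
  Lm1_deriv : ∀ (u v : V) (k : ℤ), Y (Lm1 u) v k = (-k : ℂ) • Y u v (k - 1)
  Lm1_bracket : ∀ (u v : V) (k : ℤ),
      Lm1 (Y u v k) - Y u (Lm1 v) k = (-k : ℂ) • Y u v (k - 1)
  duality : ∀ (u₁ u₂ v : V) (v' : V →ₗ[ℂ] ℂ), GradedFunctionalZ grading v' →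
    ∃ f : (Fin 2 → ℂ) → ℂ, RatFull 2 f ∧
      (∀ z₁ z₂ : ℂ, ‖z₁‖ > ‖z₂‖ → z₂ ≠ 0 →
        HasSum (fun k : ℤ × ℤ =>
          v' (Y u₁ (Y u₂ v k.2) k.1) * z₁ ^ (-k.1 - 1) * z₂ ^ (-k.2 - 1)) (f ![z₁, z₂])) ∧
      (∀ z₁ z₂ : ℂ, ‖z₂‖ > ‖z₁‖ → z₁ ≠ 0 →
        HasSum (fun k : ℤ × ℤ =>
          v' (Y u₂ (Y u₁ v k.1) k.2) * z₁ ^ (-k.1 - 1) * z₂ ^ (-k.2 - 1)) (f ![z₁, z₂])) ∧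
      (∀ z₁ z₂ : ℂ, ‖z₂‖ > ‖z₁ - z₂‖ → z₁ ≠ z₂ → z₂ ≠ 0 →
        HasSum (fun k : ℤ × ℤ =>
          v' (Y (Y u₁ u₂ k.1) v k.2) * (z₁ - z₂) ^ (-k.1 - 1) * z₂ ^ (-k.2 - 1))
          (f ![z₁, z₂]))

/-- A grading-restricted generalized module structure on `W` for a
grading-restricted vertex algebra structure `A` on `V`. -/
structure GRMod (A : GRVA V) where
  grading : ℂ → Submodule ℂ W
  decomp : DirectSum.Decomposition grading
  lower_trunc : ∃ N : ℝ, ∀ c : ℂ, c.re < N → grading c = ⊥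
  Y : V →ₗ[ℂ] W →ₗ[ℂ] (ℤ → W)
  trunc : ∀ (u : V) (w : W), ∃ N : ℤ, ∀ k : ℤ, N ≤ k → Y u w k = 0
  identity : ∀ (w : W) (k : ℤ), Y A.vacuum w k = if k = -1 then w else 0
  L0 : Module.End ℂ W
  Lm1 : Module.End ℂ W
  L0_mem : ∀ (c : ℂ) (w : W), w ∈ grading c → L0 w ∈ grading c
  Lm1_mem : ∀ (c : ℂ) (w : W), w ∈ grading c → Lm1 w ∈ grading (c + 1)
  L0_bracket : ∀ (u : V) (w : W) (k : ℤ), L0 (Y u w k)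
      = Y (A.L0 u) w k + Y u (L0 w) k + ((-k - 1 : ℤ) : ℂ) • Y u w k
  L0_nilpotent : ∀ (c : ℂ) (w : W), w ∈ grading c →
      ∃ K : ℕ, ((L0 - c • 1) ^ K) w = 0
  Lm1_deriv : ∀ (u : V) (w : W) (k : ℤ), Y (A.Lm1 u) w k = (-k : ℂ) • Y u w (k - 1)
  Lm1_bracket : ∀ (u : V) (w : W) (k : ℤ),
      Lm1 (Y u w k) - Y u (Lm1 w) k = (-k : ℂ) • Y u w (k - 1)
  duality : ∀ (u₁ u₂ : V) (w : W) (w' : W →ₗ[ℂ] ℂ), GradedFunctionalC grading w' →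
    ∃ f : (Fin 2 → ℂ) → ℂ, RatFull 2 f ∧
      (∀ z₁ z₂ : ℂ, ‖z₁‖ > ‖z₂‖ → z₂ ≠ 0 →
        HasSum (fun k : ℤ × ℤ =>
          w' (Y u₁ (Y u₂ w k.2) k.1) * z₁ ^ (-k.1 - 1) * z₂ ^ (-k.2 - 1)) (f ![z₁, z₂])) ∧
      (∀ z₁ z₂ : ℂ, ‖z₂‖ > ‖z₁‖ → z₁ ≠ 0 →
        HasSum (fun k : ℤ × ℤ =>
          w' (Y u₂ (Y u₁ w k.1) k.2) * z₁ ^ (-k.1 - 1) * z₂ ^ (-k.2 - 1)) (f ![z₁, z₂])) ∧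
      (∀ z₁ z₂ : ℂ, ‖z₂‖ > ‖z₁ - z₂‖ → z₁ ≠ z₂ → z₂ ≠ 0 →
        HasSum (fun k : ℤ × ℤ =>
          w' (Y (A.Y u₁ u₂ k.1) w k.2) * (z₁ - z₂) ^ (-k.1 - 1) * z₂ ^ (-k.2 - 1))
          (f ![z₁, z₂]))

variable {V W}

/-! ## Algebraic completions -/

/-- The algebraic completion `W̄ = ∏_{c ∈ ℂ} W_(c)` of a `ℂ`-graded module. -/
abbrev WbarT {A : GRVA V} (M : GRMod V W A) : Type := ∀ c : ℂ, M.grading c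

/-- The algebraic completion `V̄ = ∏_{k ∈ ℤ} V_(k)`. -/
abbrev VbarT (A : GRVA V) : Type := ∀ k : ℤ, A.grading k

/-- The pairing `⟨w', ω⟩` of an element `w'` of the graded dual `W'` with an
element `ω` of the algebraic completion `W̄`. -/
def pairBar {A : GRVA V} {M : GRMod V W A} (w' : W →ₗ[ℂ] ℂ) (ω : WbarT M) : ℂ :=
  ∑ᶠ c : ℂ, w' (ω c : W)

/-- The pairing of an element of the graded dual `V'` with an element of `V̄`. -/
def pairBarV {A : GRVA V} (v' : V →ₗ[ℂ] ℂ) (ω : VbarT A) : ℂ :=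
  ∑ᶠ k : ℤ, v' (ω k : V)

/-- The homogeneous component `P_r ω ∈ V` of `ω ∈ V̄` for `r ∈ ℂ`
(zero when `r` is not an integer). -/
def VbarComp {A : GRVA V} (ω : VbarT A) (r : ℂ) : V :=
  if h : ∃ k : ℤ, (k : ℂ) = r then (ω h.choose : V) else 0

/-! ## Iterated vertex operators -/

/-- `applyList Yop v k L w` applies the coefficients `(Yop (v t)) · (k t)` of the
vertex operators at the positions listed in `L` (head outermost) to `w`. -/
def applyList {X : Type} [AddCommGroup X] [Module ℂ X] {n : ℕ}
    (Yop : V →ₗ[ℂ] X →ₗ[ℂ] (ℤ → X)) (v : Fin n → V) (k : Fin n → ℤ) :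
    List (Fin n) → X → X
  | [], w => w
  | t :: ts, w => Yop (v t) (applyList Yop v k ts w) (k t)

/-- The coefficient of `z^{-p-1}` in `Y^W_{WV}(w, z)v = e^{zL_W(-1)} Y_W(v, -z)w`. -/
def YWVcoef {A : GRVA V} (M : GRMod V W A) (w : W) (v : V) (p : ℤ) : W :=
  ∑ᶠ m : ℕ, (((m.factorial : ℂ))⁻¹ * (-1 : ℂ) ^ ((m : ℤ) - p)) •
    ((M.Lm1 ^ m) (M.Y v w ((m : ℤ) - p - 1)))

/-! ## The `E`-families: products of vertex operators with values in completions -/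

/-- `IsEVFam A EV` says that `EV l v z ∈ V̄` realizes
`(E^{(l)}_V(v₁ ⊗ ⋯ ⊗ v_l; 𝟏))(z₁, …, z_l) = E(Y_V(v₁,z₁) ⋯ Y_V(v_l,z_l)𝟏)`:
its pairing with every graded functional `v'` is the rational extension (with only
possible poles on the diagonals) of the series of products of `l` vertex operators
acting on the vacuum, which converges in the region `|z₁| > ⋯ > |z_l| > 0`. -/
def IsEVFam (A : GRVA V) (EV : ∀ l : ℕ, (Fin l → V) → (Fin l → ℂ) → VbarT A) : Prop :=
  ∀ (l : ℕ) (v : Fin l → V) (v' : V →ₗ[ℂ] ℂ), GradedFunctionalZ A.grading v' →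
    ∃ f : (Fin l → ℂ) → ℂ, RatDiag l f ∧
      (∀ z : Fin l → ℂ, (List.finRange l).Chain' (fun s t => ‖z s‖ > ‖z t‖) →
          (∀ t, z t ≠ 0) →
        HasSum (fun k : Fin l → ℤ =>
          v' (applyList A.Y v k (List.finRange l) A.vacuum) *
            ∏ t, z t ^ (-(k t) - 1)) (f z)) ∧
      (∀ z, (∀ s t, s ≠ t → z s ≠ z t) → pairBarV v' (EV l v z) = f z)

/-- `IsEWFam A M EW` says that `EW m v u z ∈ W̄` realizes
`(E^{(m)}_W(v₁ ⊗ ⋯ ⊗ v_m; u))(z₁, …, z_m) = E(Y_W(v₁,z₁) ⋯ Y_W(v_m,z_m)u)`: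
its pairing with every graded functional `w'` is the rational extension (with only
possible poles at `z i = z j` and `z i = 0`) of the series of products of `m` module
vertex operators acting on `u`, convergent for `|z₁| > ⋯ > |z_m| > 0`. -/
def IsEWFam {A : GRVA V} (M : GRMod V W A)
    (EW : ∀ m : ℕ, (Fin m → V) → W → (Fin m → ℂ) → WbarT M) : Prop :=
  ∀ (m : ℕ) (v : Fin m → V) (u : W) (w' : W →ₗ[ℂ] ℂ), GradedFunctionalC M.grading w' →
    ∃ f : (Fin m → ℂ) → ℂ, RatFull m f ∧
      (∀ z : Fin m → ℂ, (List.finRange m).Chain' (fun s t => ‖z s‖ > ‖z t‖) →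
          (∀ t, z t ≠ 0) →
        HasSum (fun k : Fin m → ℤ =>
          w' (applyList M.Y v k (List.finRange m) u) *
            ∏ t, z t ^ (-(k t) - 1)) (f z)) ∧
      (∀ z, (∀ s t, s ≠ t → z s ≠ z t) → (∀ t, z t ≠ 0) →
        pairBar w' (EW m v u z) = f z)

/-- `IsEWV1Fam A M G` says that `G m u v ζz ∈ W̄` realizes
`(E^{W;(1,m)}_{WV}(u; v₁ ⊗ ⋯ ⊗ v_m))(ζ, z₁, …, z_m)
  = E(Y^W_{WV}(u,ζ) Y_V(v₁,z₁) ⋯ Y_V(v_m,z_m)𝟏)`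
(first variable is the `ζ`-slot of `Y^W_{WV}`): its pairing with every graded
functional is the rational extension (poles only on diagonals) of the corresponding
series, convergent for `|ζ| > |z₁| > ⋯ > |z_m| > 0`. -/
def IsEWV1Fam {A : GRVA V} (M : GRMod V W A)
    (G : ∀ m : ℕ, W → (Fin m → V) → (Fin (m + 1) → ℂ) → WbarT M) : Prop :=
  ∀ (m : ℕ) (u : W) (v : Fin m → V) (w' : W →ₗ[ℂ] ℂ), GradedFunctionalC M.grading w' →
    ∃ f : (Fin (m + 1) → ℂ) → ℂ, RatDiag (m + 1) f ∧
      (∀ z : Fin (m + 1) → ℂ,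
          (List.finRange (m + 1)).Chain' (fun s t => ‖z s‖ > ‖z t‖) →
          (∀ t, z t ≠ 0) →
        HasSum (fun k : Fin (m + 1) → ℤ =>
          w' (YWVcoef M u
              (applyList A.Y v (fun t => k t.succ) (List.finRange m) A.vacuum) (k 0)) *
            ∏ t, z t ^ (-(k t) - 1)) (f z)) ∧
      (∀ z, (∀ s t, s ≠ t → z s ≠ z t) → pairBar w' (G m u v z) = f z)

/-- `IsEn1Fam A M E` says that `E m v u zζ ∈ W̄` realizes
`(E^{(m,1)}_W(v₁ ⊗ ⋯ ⊗ v_m; u))(z₁, …, z_m, ζ)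
  = E(Y_W(v₁,z₁) ⋯ Y_W(v_m,z_m) Y^W_{WV}(u,ζ)𝟏)`
(the last variable is the `ζ`-slot): its pairing with every graded functional is
the rational extension (poles only on diagonals) of the corresponding series,
convergent for `|z₁| > ⋯ > |z_m| > |ζ| > 0`. -/
def IsEn1Fam {A : GRVA V} (M : GRMod V W A)
    (E : ∀ m : ℕ, (Fin m → V) → W → (Fin (m + 1) → ℂ) → WbarT M) : Prop :=
  ∀ (m : ℕ) (v : Fin m → V) (u : W) (w' : W →ₗ[ℂ] ℂ), GradedFunctionalC M.grading w' →
    ∃ f : (Fin (m + 1) → ℂ) → ℂ, RatDiag (m + 1) f ∧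
      (∀ z : Fin (m + 1) → ℂ,
          (List.finRange (m + 1)).Chain' (fun s t => ‖z s‖ > ‖z t‖) →
          (∀ t, z t ≠ 0) →
        HasSum (fun k : Fin (m + 1) → ℤ =>
          w' (applyList M.Y v (fun t => k t.castSucc) (List.finRange m)
              (YWVcoef M u A.vacuum (k (Fin.last m)))) *
            ∏ t, z t ^ (-(k t) - 1)) (f z)) ∧
      (∀ z, (∀ s t, s ≠ t → z s ≠ z t) → pairBar w' (E m v u z) = f z)

/-! ## Cochains -/

/-- The space of `n`-cochains: linear maps from `V^{⊗n}` to the space of functions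
from `n`-tuples of complex numbers to `W̄` (only the restriction to the configuration
space `F_nℂ` is relevant; `W̄`-valued rationality is imposed separately). -/
abbrev Cochain {A : GRVA V} (M : GRMod V W A) (n : ℕ) :=
  MultilinearMap ℂ (fun _ : Fin n => V) ((Fin n → ℂ) → WbarT M)

/-- `Φ` takes values in `W̄`-valued rational functions with the only possible poles
at `z i = z j`, `i ≠ j` (i.e. in `W̃_{z₁,…,zₙ}`). -/
def TakesRatValues {A : GRVA V} {M : GRMod V W A} {n : ℕ} (Φ : Cochain M n) : Prop :=
  ∀ (v : Fin n → V) (w' : W →ₗ[ℂ] ℂ), GradedFunctionalC M.grading w' →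
    RatDiag n (fun z => pairBar w' (Φ v z))

/-- Pre-composition of the complex variables with an equivalence, as a linear map. -/
def precompZ {X : Type} [AddCommGroup X] [Module ℂ X] {a b : ℕ} (e : Fin a ≃ Fin b) :
    ((Fin a → ℂ) → X) →ₗ[ℂ] ((Fin b → ℂ) → X) where
  toFun f := fun zb => f (fun i => zb (e i))
  map_add' _ _ := rfl
  map_smul' _ _ := rfl

/-- Transport of a cochain along an identification of index sets; for `e = σ ∈ Sₙ`
this is the action `(σ(Φ))(v₁ ⊗ ⋯ ⊗ vₙ) = σ(Φ(v_{σ(1)} ⊗ ⋯ ⊗ v_{σ(n)}))`,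
i.e. `(transport σ Φ) v z = Φ (v ∘ σ) (z ∘ σ)`. -/
def transport {A : GRVA V} {M : GRMod V W A} {a b : ℕ} (e : Fin a ≃ Fin b)
    (Φ : Cochain M a) : Cochain M b :=
  (precompZ e).compMultilinearMap (MultilinearMap.domDomCongr e Φ)
/-! ## Operators on the algebraic completion -/

lemma Lm1_pow_mem {A : GRVA V} (M : GRMod V W A) (m : ℕ) (c : ℂ) (w : W)
    (h : w ∈ M.grading c) : (M.Lm1 ^ m) w ∈ M.grading (c + m) := by
  induction m generalizing c w with
  | zero => simpa using h
  | succ K ih =>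
    have h1 : (M.Lm1 ^ (K + 1)) w = (M.Lm1 ^ K) (M.Lm1 w) := by
      rw [pow_succ]; rfl
    have h2 := ih (c + 1) (M.Lm1 w) (M.Lm1_mem c w h)
    have h3 : c + 1 + (K : ℂ) = c + ((K : ℕ) + 1 : ℕ) := by push_cast; ring
    rw [h1]
    rw [h3] at h2
    exact h2

/-- The extension of `L_W(-1)` to the algebraic completion `W̄`. -/
def Lm1bar {A : GRVA V} (M : GRMod V W A) (ω : WbarT M) : WbarT M := fun c =>
  ⟨M.Lm1 (ω (c - 1) : W), by
    have h := M.Lm1_mem (c - 1) _ (ω (c - 1)).2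
    have h2 : c - 1 + 1 = c := by ring
    rwa [h2] at h⟩

/-- The operator `e^{ζ L_W(-1)}` on the algebraic completion `W̄`, well defined
componentwise thanks to the shift of weights and lower truncation. -/
def expLm1 {A : GRVA V} (M : GRMod V W A) (ζ : ℂ) (ω : WbarT M) : WbarT M := fun c =>
  ∑ᶠ m : ℕ, ((ζ ^ m * ((m.factorial : ℂ))⁻¹) •
    (⟨(M.Lm1 ^ m) (ω (c - m) : W), by
        have h := Lm1_pow_mem M m (c - m) _ (ω (c - m)).2
        have h2 : c - (m : ℂ) + m = c := by ring
        rwa [h2] at h⟩ : M.grading c))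

lemma L0nil_mem {A : GRVA V} (M : GRMod V W A) (K : ℕ) (c : ℂ) (w : W)
    (h : w ∈ M.grading c) : ((M.L0 - c • 1) ^ K) w ∈ M.grading c := by
  induction K generalizing w with
  | zero => simpa using h
  | succ K ih =>
    have h1 : ((M.L0 - c • 1) ^ (K + 1)) w = ((M.L0 - c • 1) ^ K) ((M.L0 - c • 1) w) := by
      rw [pow_succ]; rfl
    rw [h1]
    apply ih
    have h2 : (M.L0 - c • 1) w = M.L0 w - c • w := by
      simp [LinearMap.sub_apply]
    rw [h2]
    exact Submodule.sub_mem _ (M.L0_mem c w h) (Submodule.smul_mem _ c h)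

/-- The operator `z^{L_W(0)} = e^{(log z)(L_W(0))_s} e^{(log z)(L_W(0)-(L_W(0))_s)}`
on the algebraic completion `W̄`, defined using the semisimple part (which acts on
`W_(c)` as multiplication by `c`) and the locally nilpotent part of `L_W(0)`. -/
def zL0bar {A : GRVA V} (M : GRMod V W A) (z : ℂ) (ω : WbarT M) : WbarT M := fun c =>
  Complex.exp (Complex.log z * c) •
    ∑ᶠ K : ℕ, (((Complex.log z) ^ K * ((K.factorial : ℂ))⁻¹) •
      (⟨((M.L0 - c • 1) ^ K) (ω c : W), L0nil_mem M K c _ (ω c).2⟩ : M.grading c))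

/-- The operator `z^{L_V(0)}` on `V` (semisimple, integral weights). -/
def zL0V (A : GRVA V) (z : ℂ) (v : V) : V :=
  letI := A.decomp
  ∑ᶠ k : ℤ, (z ^ k) • ((DirectSum.decompose A.grading v k : V))

/-! ## The `L(-1)`-derivative and `L(0)`-conjugation properties -/

/-- The `L(-1)`-derivative property for a cochain `Φ`. -/
def HasL1D {A : GRVA V} {M : GRMod V W A} {n : ℕ} (Φ : Cochain M n) : Prop :=
  (∀ (v : Fin n → V) (w' : W →ₗ[ℂ] ℂ), GradedFunctionalC M.grading w' →
    ∀ (i : Fin n) (z : Fin n → ℂ), (∀ s t, s ≠ t → z s ≠ z t) →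
      HasDerivAt (fun t => pairBar w' (Φ v (Function.update z i t)))
        (pairBar w' (Φ (Function.update v i (A.Lm1 (v i))) z)) (z i)) ∧
  (∀ (v : Fin n → V) (w' : W →ₗ[ℂ] ℂ), GradedFunctionalC M.grading w' →
    ∀ z : Fin n → ℂ, (∀ s t, s ≠ t → z s ≠ z t) →
      ∑ i : Fin n, pairBar w' (Φ (Function.update v i (A.Lm1 (v i))) z)
        = pairBar w' (Lm1bar M (Φ v z)))

/-- The `L(0)`-conjugation property for a cochain `Φ`. -/
def HasL0conj {A : GRVA V} {M : GRMod V W A} {n : ℕ} (Φ : Cochain M n) : Prop :=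
  ∀ (v : Fin n → V) (w' : W →ₗ[ℂ] ℂ), GradedFunctionalC M.grading w' →
    ∀ (z : ℂ) (zs : Fin n → ℂ), z ≠ 0 → (∀ s t, s ≠ t → zs s ≠ zs t) →
      pairBar w' (zL0bar M z (Φ v zs))
        = pairBar w' (Φ (fun i => zL0V A z (v i)) (fun i => z * zs i))
/-! ## Block embeddings -/

/-- Starting index of the `i`-th block of sizes `l`. -/
def blockStart {n : ℕ} (l : Fin n → ℕ) (i : Fin n) : ℕ :=
  ∑ j ∈ Finset.univ.filter (fun j => j < i), l j

lemma blockEmb_lt {n m : ℕ} (l : Fin n → ℕ) (hsum : ∑ i, l i = m) (i : Fin n)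
    (p : Fin (l i)) : blockStart l i + (p : ℕ) < m := by
  have hp : (p : ℕ) < l i := p.2
  have h2 : blockStart l i + l i ≤ m := by
    rw [← hsum]
    have hnotin : i ∉ Finset.univ.filter (fun j => j < i) := by simp
    have : blockStart l i + l i = ∑ j ∈ insert i (Finset.univ.filter (fun j => j < i)), l j := by
      rw [Finset.sum_insert hnotin, Nat.add_comm]; rfl
    rw [this]
    exact Finset.sum_le_sum_of_subset (by intro x _; simp)
  omega

/-- The embedding of the `p`-th position of the `i`-th block into `Fin m`,
where the blocks have sizes `l 0, …, l (n-1)` with `∑ l = m`. -/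
def blockEmb {n m : ℕ} (l : Fin n → ℕ) (hsum : ∑ i, l i = m) (i : Fin n)
    (p : Fin (l i)) : Fin m :=
  ⟨blockStart l i + (p : ℕ), blockEmb_lt l hsum i p⟩

/-! ## Composability with vertex operators -/

/-- `Φ : V^{⊗n} → W̃` is composable with `m` vertex operators (Definition 3.3):
the two families of series obtained by substituting products of vertex operators
acting on the vacuum into the arguments of `Φ` (condition 1) and by applying `m`
module vertex operators to the value of `Φ` (condition 2) converge absolutely in
the indicated regions to rational functions with only possible poles at
`z i = z j` of orders bounded by positive integers `N(v i, v j)` depending only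
on `v i` and `v j`.  The auxiliary `V̄`- and `W̄`-valued products are encoded by
families `EV`, `EW` satisfying `IsEVFam`, `IsEWFam`. -/
def Composable {A : GRVA V} {M : GRMod V W A}
    (EV : ∀ l : ℕ, (Fin l → V) → (Fin l → ℂ) → VbarT A)
    (EW : ∀ m : ℕ, (Fin m → V) → W → (Fin m → ℂ) → WbarT M)
    {n : ℕ} (m : ℕ) (Φ : Cochain M n) : Prop :=
  (∃ Nb : V → V → ℕ, (∀ a b, 0 < Nb a b) ∧
    ∀ (l : Fin n → ℕ), (∀ i, 0 < l i) → ∀ (hsum : ∑ i, l i = m + n)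
      (v : Fin (m + n) → V) (w' : W →ₗ[ℂ] ℂ), GradedFunctionalC M.grading w' →
    ∃ f : (Fin (m + n) → ℂ) → ℂ,
      RatDiagBnd (m + n) (fun s t => Nb (v s) (v t)) f ∧
      ∀ (ζ : Fin n → ℂ) (z : Fin (m + n) → ℂ),
        (∀ i j : Fin n, i ≠ j → ζ i ≠ ζ j) →
        (∀ i j : Fin n, i ≠ j → ∀ (p : Fin (l i)) (q : Fin (l j)),
          ‖z (blockEmb l hsum i p) - ζ i‖ + ‖z (blockEmb l hsum j q) - ζ j‖
            < ‖ζ i - ζ j‖) →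
        (∀ (i : Fin n) (p q : Fin (l i)), p ≠ q →
          z (blockEmb l hsum i p) ≠ z (blockEmb l hsum i q)) →
        HasSum (fun r : Fin n → ℤ =>
          pairBar w' (Φ (fun i =>
            ((EV (l i) (fun p => v (blockEmb l hsum i p))
              (fun p => z (blockEmb l hsum i p) - ζ i)) (r i) : V)) ζ)) (f z)) ∧
  (∃ Nb : V → V → ℕ, (∀ a b, 0 < Nb a b) ∧
    ∀ (v : Fin (m + n) → V) (w' : W →ₗ[ℂ] ℂ), GradedFunctionalC M.grading w' →
    ∃ f : (Fin (m + n) → ℂ) → ℂ,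
      RatDiagBnd (m + n) (fun s t => Nb (v s) (v t)) f ∧
      ∀ z : Fin (m + n) → ℂ, (∀ s t, s ≠ t → z s ≠ z t) →
        (∀ (i : Fin m) (j : Fin n), ‖z (Fin.castAdd n i)‖ > ‖z (Fin.natAdd m j)‖) →
        (∀ j : Fin n, z (Fin.natAdd m j) ≠ 0) →
        HasSum (fun q : ℂ =>
          pairBar w' (EW m (fun i => v (Fin.castAdd n i))
            ((Φ (fun j => v (Fin.natAdd m j)) (fun j => z (Fin.natAdd m j)) q : W))
            (fun i => z (Fin.castAdd n i)))) (f z))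

/-- `Ψ` realizes the composition `Φ ∘ (E^{(l₁)}_{V;𝟏} ⊗ ⋯ ⊗ E^{(lₙ)}_{V;𝟏})`,
defined through the absolutely convergent series of condition 1 of composability
and rational extension. -/
def IsCompE {A : GRVA V} {M : GRMod V W A}
    (EV : ∀ l : ℕ, (Fin l → V) → (Fin l → ℂ) → VbarT A)
    {n : ℕ} (Φ : Cochain M n) (m' : ℕ) (l : Fin n → ℕ) (hsum : ∑ i, l i = m')
    (Ψ : Cochain M m') : Prop :=
  ∀ (v : Fin m' → V) (w' : W →ₗ[ℂ] ℂ), GradedFunctionalC M.grading w' →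
    RatDiag m' (fun z => pairBar w' (Ψ v z)) ∧
    ∀ (ζ : Fin n → ℂ) (z : Fin m' → ℂ),
      (∀ i j : Fin n, i ≠ j → ζ i ≠ ζ j) →
      (∀ s t : Fin m', s ≠ t → z s ≠ z t) →
      (∀ i j : Fin n, i ≠ j → ∀ (p : Fin (l i)) (q : Fin (l j)),
        ‖z (blockEmb l hsum i p) - ζ i‖ + ‖z (blockEmb l hsum j q) - ζ j‖
          < ‖ζ i - ζ j‖) →
      HasSum (fun r : Fin n → ℤ =>
        pairBar w' (Φ (fun i =>
          ((EV (l i) (fun p => v (blockEmb l hsum i p))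
            (fun p => z (blockEmb l hsum i p) - ζ i)) (r i) : V)) ζ))
        (pairBar w' (Ψ v z))

/-- `Ψ` realizes the composition `E^{(p)}_W ∘_{p+1} Φ` (applying `p` module vertex
operators to the left of the value of `Φ`), defined through the absolutely
convergent series of condition 2 of composability and rational extension. -/
def IsCompW {A : GRVA V} {M : GRMod V W A}
    (EW : ∀ m : ℕ, (Fin m → V) → W → (Fin m → ℂ) → WbarT M)
    {n : ℕ} (Φ : Cochain M n) (p : ℕ) (Ψ : Cochain M (p + n)) : Prop :=
  ∀ (v : Fin (p + n) → V) (w' : W →ₗ[ℂ] ℂ), GradedFunctionalC M.grading w' →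
    RatDiag (p + n) (fun z => pairBar w' (Ψ v z)) ∧
    ∀ z : Fin (p + n) → ℂ, (∀ s t, s ≠ t → z s ≠ z t) →
      (∀ (i : Fin p) (j : Fin n), ‖z (Fin.castAdd n i)‖ > ‖z (Fin.natAdd p j)‖) →
      (∀ j : Fin n, z (Fin.natAdd p j) ≠ 0) →
      HasSum (fun q : ℂ =>
        pairBar w' (EW p (fun i => v (Fin.castAdd n i))
          ((Φ (fun j => v (Fin.natAdd p j)) (fun j => z (Fin.natAdd p j)) q : W))
          (fun i => z (Fin.castAdd n i)))) (pairBar w' (Ψ v z))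

/-- `Ψ` realizes the composition `E^{W;(m)}_{WV} ∘₀ Φ` (substituting the value of
`Φ` into the `W`-argument of `E^{W;(m)}_{WV} = E^{W;(1,m)}_{WV}(·)(0, ·)`). -/
def IsCompWV {A : GRVA V} {M : GRMod V W A}
    (G : ∀ m : ℕ, W → (Fin m → V) → (Fin (m + 1) → ℂ) → WbarT M)
    {n : ℕ} (Φ : Cochain M n) (m : ℕ) (Ψ : Cochain M (n + m)) : Prop :=
  ∀ (v : Fin (n + m) → V) (w' : W →ₗ[ℂ] ℂ), GradedFunctionalC M.grading w' →
    RatDiag (n + m) (fun z => pairBar w' (Ψ v z)) ∧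
    ∀ z : Fin (n + m) → ℂ, (∀ s t, s ≠ t → z s ≠ z t) →
      (∀ (j : Fin m) (i : Fin n), ‖z (Fin.natAdd n j)‖ > ‖z (Fin.castAdd m i)‖) →
      (∀ i : Fin n, z (Fin.castAdd m i) ≠ 0) →
      HasSum (fun q : ℂ =>
        pairBar w' (G m
          ((Φ (fun i => v (Fin.castAdd m i)) (fun i => z (Fin.castAdd m i)) q : W))
          (fun j => v (Fin.natAdd n j))
          (Fin.cons 0 (fun j => z (Fin.natAdd n j)))))
        (pairBar w' (Ψ v z))
/-! ## Shuffles -/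

/-- `σ ∈ J_{n;p}`: `σ` preserves the order of the first `p` positions and of the
last `n - p` positions (0-indexed). -/
def IsShuffle {n : ℕ} (p : ℕ) (σ : Equiv.Perm (Fin n)) : Prop :=
  (∀ s t : Fin n, s < t → (t : ℕ) < p → σ s < σ t) ∧
  (∀ s t : Fin n, s < t → p ≤ (s : ℕ) → σ s < σ t)

/-- The shuffle condition defining the subcomplex `C^n_•(V,W)`: for every
`1 ≤ p ≤ n-1` the signed sum over shuffles of the permuted cochains vanishes
on the configuration space. -/
def ShuffleVanish {A : GRVA V} {M : GRMod V W A} {n : ℕ} (Φ : Cochain M n) : Prop :=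
  ∀ p : ℕ, 1 ≤ p → p ≤ n - 1 →
    ∀ (v : Fin n → V) (z : Fin n → ℂ), (∀ s t, s ≠ t → z s ≠ z t) →
      ∑ σ ∈ Finset.univ.filter (fun σ : Equiv.Perm (Fin n) => IsShuffle p σ),
        ((Equiv.Perm.sign σ : ℤ) : ℂ) • (transport σ Φ) v z = 0

/-! ## The coboundary operator -/

lemma sum_delta_block (n : ℕ) (i : Fin n) :
    ∑ j : Fin n, (if j = i then 2 else 1) = n + 1 := by
  have h : ∀ j : Fin n, (if j = i then 2 else 1) = (if j = i then 1 else 0) + 1 := by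
    intro j; split <;> rfl
  simp only [h, Finset.sum_add_distrib, Finset.sum_ite_eq' Finset.univ i (fun _ => 1)]
  simp [Nat.add_comm]

/-- `Θ` is a realization of the coboundary
`δ̂ⁿ(Φ) = E^{(1)}_W ∘₂ Φ + ∑_{i=1}^n (-1)^i Φ ∘ᵢ E^{(2)}_{V;𝟏}
          + (-1)^{n+1} E^{W;(1)}_{WV} ∘₀ Φ`
on the configuration space, where the three kinds of compositions are encoded by
the predicates `IsCompW`, `IsCompE`, `IsCompWV`. -/
def IsDelta {A : GRVA V} {M : GRMod V W A}
    (EV : ∀ l : ℕ, (Fin l → V) → (Fin l → ℂ) → VbarT A)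
    (EW : ∀ m : ℕ, (Fin m → V) → W → (Fin m → ℂ) → WbarT M)
    (G : ∀ m : ℕ, W → (Fin m → V) → (Fin (m + 1) → ℂ) → WbarT M)
    {n : ℕ} (Φ : Cochain M n) (Θ : Cochain M (n + 1)) : Prop :=
  ∃ (Aw : Cochain M (1 + n)) (B : Fin n → Cochain M (n + 1)) (Cw : Cochain M (n + 1)),
    IsCompW EW Φ 1 Aw ∧
    (∀ i : Fin n, IsCompE EV Φ (n + 1) (fun j => if j = i then 2 else 1)
      (sum_delta_block n i) (B i)) ∧
    IsCompWV G Φ 1 Cw ∧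
    (∀ (v : Fin (n + 1) → V) (z : Fin (n + 1) → ℂ), (∀ s t, s ≠ t → z s ≠ z t) →
      Θ v z = (transport (finCongr (Nat.add_comm 1 n)) Aw) v z
        + (∑ i : Fin n, ((-1 : ℂ) ^ ((i : ℕ) + 1)) • B i) v z
        + (((-1 : ℂ) ^ (n + 1)) • Cw) v z)

/-- Membership in `Ĉⁿₘ(V,W)` (before imposing the shuffle condition):
`W̃`-valued rationality, the `L(-1)`-derivative and `L(0)`-conjugation properties,
and composability with `m` vertex operators. -/
def HatCmem {A : GRVA V} {M : GRMod V W A}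
    (EV : ∀ l : ℕ, (Fin l → V) → (Fin l → ℂ) → VbarT A)
    (EW : ∀ m : ℕ, (Fin m → V) → W → (Fin m → ℂ) → WbarT M)
    {n : ℕ} (m : ℕ) (Φ : Cochain M n) : Prop :=
  TakesRatValues Φ ∧ HasL1D Φ ∧ HasL0conj Φ ∧ Composable EV EW m Φ

/-- Membership in `Cⁿₘ(V,W)`: membership in `Ĉⁿₘ(V,W)` together with the
vanishing of all shuffle sums. -/
def Cmem {A : GRVA V} {M : GRMod V W A}
    (EV : ∀ l : ℕ, (Fin l → V) → (Fin l → ℂ) → VbarT A)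
    (EW : ∀ m : ℕ, (Fin m → V) → W → (Fin m → ℂ) → WbarT M)
    {n : ℕ} (m : ℕ) (Φ : Cochain M n) : Prop :=
  HatCmem EV EW m Φ ∧ ShuffleVanish Φ
/-! ## The extra second coboundary `δ̂²_{1/2}` -/

/-- The data of the two combined absolutely convergent series (and their rational
extensions `f`, `g`) entering the definition of `Ĉ²_{1/2}(V,W)` and of
`δ̂²_{1/2}` for a 2-cochain `Φ`, for fixed `v₁,v₂,v₃` and `w'`. -/
def HalfDeltaData {A : GRVA V} {M : GRMod V W A}
    (EV : ∀ l : ℕ, (Fin l → V) → (Fin l → ℂ) → VbarT A)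
    (En1 : ∀ m : ℕ, (Fin m → V) → W → (Fin (m + 1) → ℂ) → WbarT M)
    (G : ∀ m : ℕ, W → (Fin m → V) → (Fin (m + 1) → ℂ) → WbarT M)
    (Φ : Cochain M 2) (v : Fin 3 → V) (w' : W →ₗ[ℂ] ℂ)
    (f g : (Fin 3 → ℂ) → ℂ) : Prop :=
  RatFull 3 f ∧ RatFull 3 g ∧
  (∀ z₁ z₂ z₃ ζ : ℂ, ‖z₁ - ζ‖ > ‖z₂ - ζ‖ → ‖z₁ - ζ‖ > ‖z₃ - ζ‖ →
      z₂ ≠ ζ → z₃ ≠ ζ → z₂ ≠ z₃ → z₁ ≠ ζ →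
    HasSum (fun r : ℂ =>
      pairBar w' (En1 1 ![v 0] ((Φ ![v 1, v 2] ![z₂ - ζ, z₃ - ζ]) r : W) ![z₁, ζ])
      + pairBar w' (Φ ![v 0, VbarComp (EV 2 ![v 1, v 2] ![z₂ - ζ, z₃ - ζ]) r] ![z₁, ζ]))
      (f ![z₁, z₂, z₃])) ∧
  (∀ z₁ z₂ z₃ ζ : ℂ, ‖ζ - z₃‖ > ‖z₁ - ζ‖ → ‖ζ - z₃‖ > ‖z₂ - ζ‖ →
      z₁ ≠ ζ → z₂ ≠ ζ → z₁ ≠ z₂ → ζ ≠ z₃ →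
    HasSum (fun r : ℂ =>
      pairBar w' (Φ ![VbarComp (EV 2 ![v 0, v 1] ![z₁ - ζ, z₂ - ζ]) r, v 2] ![ζ, z₃])
      + pairBar w' (G 1 ((Φ ![v 0, v 1] ![z₁ - ζ, z₂ - ζ]) r : W) ![v 2] ![ζ, z₃]))
      (g ![z₁, z₂, z₃]))

/-- Membership in `Ĉ²_{1/2}(V,W)`: the two combined series converge absolutely to
rational functions with the only possible poles at `zᵢ = zⱼ` and `zᵢ = 0`. -/
def HalfComposable {A : GRVA V} {M : GRMod V W A}
    (EV : ∀ l : ℕ, (Fin l → V) → (Fin l → ℂ) → VbarT A)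
    (En1 : ∀ m : ℕ, (Fin m → V) → W → (Fin (m + 1) → ℂ) → WbarT M)
    (G : ∀ m : ℕ, W → (Fin m → V) → (Fin (m + 1) → ℂ) → WbarT M)
    (Φ : Cochain M 2) : Prop :=
  ∀ (v : Fin 3 → V) (w' : W →ₗ[ℂ] ℂ), GradedFunctionalC M.grading w' →
    ∃ f g : (Fin 3 → ℂ) → ℂ, HalfDeltaData EV En1 G Φ v w' f g

/-- `Ξ` realizes `δ̂²_{1/2}(Φ)`: the difference of the rational extensions of
the two combined series. -/
def IsDeltaHalf {A : GRVA V} {M : GRMod V W A}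
    (EV : ∀ l : ℕ, (Fin l → V) → (Fin l → ℂ) → VbarT A)
    (En1 : ∀ m : ℕ, (Fin m → V) → W → (Fin (m + 1) → ℂ) → WbarT M)
    (G : ∀ m : ℕ, W → (Fin m → V) → (Fin (m + 1) → ℂ) → WbarT M)
    (Φ : Cochain M 2) (Ξ : Cochain M 3) : Prop :=
  ∀ (v : Fin 3 → V) (w' : W →ₗ[ℂ] ℂ), GradedFunctionalC M.grading w' →
    ∃ f g : (Fin 3 → ℂ) → ℂ, HalfDeltaData EV En1 G Φ v w' f g ∧
      ∀ z : Fin 3 → ℂ, (∀ s t, s ≠ t → z s ≠ z t) →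
        pairBar w' (Ξ v z) = f z - g z

/-! ## Cocycles and coboundaries -/

/-- `Φ ∈ C^n_m(V,W)` is a cocycle: every realization of `δ̂ⁿₘ(Φ)` vanishes on the
configuration space. -/
def IsCocycle {A : GRVA V} {M : GRMod V W A}
    (EV : ∀ l : ℕ, (Fin l → V) → (Fin l → ℂ) → VbarT A)
    (EW : ∀ m : ℕ, (Fin m → V) → W → (Fin m → ℂ) → WbarT M)
    (G : ∀ m : ℕ, W → (Fin m → V) → (Fin (m + 1) → ℂ) → WbarT M)
    {n : ℕ} (m : ℕ) (Φ : Cochain M n) : Prop :=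
  Cmem EV EW m Φ ∧
    ∀ Θ : Cochain M (n + 1), IsDelta EV EW G Φ Θ →
      ∀ (v : Fin (n + 1) → V) (z : Fin (n + 1) → ℂ),
        (∀ s t, s ≠ t → z s ≠ z t) → Θ v z = 0

/-- `Φ` is a coboundary at level `m`: it agrees on the configuration space with a
realization of `δ̂ⁿ_{m+1}(Ψ)` for some `Ψ ∈ Cⁿ_{m+1}(V,W)`. -/
def IsCobound {A : GRVA V} {M : GRMod V W A}
    (EV : ∀ l : ℕ, (Fin l → V) → (Fin l → ℂ) → VbarT A)
    (EW : ∀ m : ℕ, (Fin m → V) → W → (Fin m → ℂ) → WbarT M)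
    (G : ∀ m : ℕ, W → (Fin m → V) → (Fin (m + 1) → ℂ) → WbarT M)
    {n : ℕ} (m : ℕ) (Φ : Cochain M (n + 1)) : Prop :=
  ∃ Ψ : Cochain M n, Cmem EV EW (m + 1) Ψ ∧
    ∃ Θ : Cochain M (n + 1), IsDelta EV EW G Ψ Θ ∧
      ∀ (v : Fin (n + 1) → V) (z : Fin (n + 1) → ℂ),
        (∀ s t, s ≠ t → z s ≠ z t) → Θ v z = Φ v z

/-! ## Formal series in several variables -/

/-- Multiplication of a formal series `∑ F k z^{-k-1}` by the variable `z i`. -/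
def shiftMode {X : Type*} [AddCommGroup X] [Module ℂ X] {n : ℕ} (i : Fin n) :
    Module.End ℂ ((Fin n → ℤ) → X) :=
  LinearMap.funLeft ℂ X (fun k => k + Pi.single i 1)

/-- Multiplication of a formal series `∑ F k z^{-k-1}` by `z i - z j`. -/
def diffMode {X : Type*} [AddCommGroup X] [Module ℂ X] {n : ℕ} (i j : Fin n) :
    Module.End ℂ ((Fin n → ℤ) → X) :=
  shiftMode i - shiftMode j

/-- The monomial `z^{-k-1}`. -/
def modeMonomial {n : ℕ} (z : Fin n → ℂ) (k : Fin n → ℤ) : ℂ :=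
  ∏ t, z t ^ (-(k t) - 1)

lemma shiftMode_apply {X : Type*} [AddCommGroup X] [Module ℂ X] {n : ℕ} (i : Fin n)
    (F : (Fin n → ℤ) → X) (k : Fin n → ℤ) :
    shiftMode i F k = F (k + Pi.single i 1) := rfl

lemma diffMode_apply {X : Type*} [AddCommGroup X] [Module ℂ X] {n : ℕ} (i j : Fin n)
    (F : (Fin n → ℤ) → X) (k : Fin n → ℤ) :
    diffMode i j F k = F (k + Pi.single i 1) - F (k + Pi.single j 1) := rfl

lemma diffMode_swap {X : Type*} [AddCommGroup X] [Module ℂ X] {n : ℕ} (i j : Fin n) :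
    (diffMode j i : Module.End ℂ ((Fin n → ℤ) → X)) = -diffMode i j := by
  simp [diffMode]

lemma commute_shiftMode {X : Type*} [AddCommGroup X] [Module ℂ X] {n : ℕ} (i j : Fin n) :
    Commute (shiftMode i : Module.End ℂ ((Fin n → ℤ) → X)) (shiftMode j) := by
  refine LinearMap.ext fun F => funext fun k => ?_
  simp only [Module.End.mul_apply, shiftMode_apply]
  rw [add_right_comm]

lemma commute_diffMode {X : Type*} [AddCommGroup X] [Module ℂ X] {n : ℕ} (i j s t : Fin n) :
    Commute (diffMode i j : Module.End ℂ ((Fin n → ℤ) → X)) (diffMode s t) :=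
  ((commute_shiftMode i s).sub_left (commute_shiftMode j s)).sub_right
    ((commute_shiftMode i t).sub_left (commute_shiftMode j t))

lemma modeMonomial_add_single {n : ℕ} {z : Fin n → ℂ} (hz : ∀ t, z t ≠ 0)
    (k : Fin n → ℤ) (i : Fin n) (m : ℤ) :
    modeMonomial z (k + Pi.single i m) = modeMonomial z k * z i ^ (-m) := by
  have h : ∀ t, z t ^ (-((k + Pi.single i m : Fin n → ℤ) t) - 1)
      = z t ^ (-(k t) - 1) * (if t = i then z i ^ (-m) else 1) := by
    intro t
    by_cases ht : t = i
    · subst ht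
      rw [if_pos rfl, ← zpow_add₀ (hz t)]
      congr 1
      simp
      ring
    · simp [ht]
  simp only [modeMonomial, h, Finset.prod_mul_distrib]
  simp

lemma hasSum_shiftMode {n : ℕ} {z : Fin n → ℂ} (hz : ∀ t, z t ≠ 0) (i : Fin n)
    {F : (Fin n → ℤ) → ℂ} {S : ℂ} (h : HasSum (fun k => F k * modeMonomial z k) S) :
    HasSum (fun k => shiftMode i F k * modeMonomial z k) (z i * S) := by
  have h1 := ((Equiv.addRight (Pi.single i (1 : ℤ))).hasSum_iff.mpr h).mul_left (z i)
  refine h1.congr_fun fun k => ?_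
  simp only [Function.comp_apply, Equiv.coe_addRight, shiftMode_apply,
    modeMonomial_add_single hz]
  have := hz i
  field_simp

lemma hasSum_diffMode {n : ℕ} {z : Fin n → ℂ} (hz : ∀ t, z t ≠ 0) (i j : Fin n)
    {F : (Fin n → ℤ) → ℂ} {S : ℂ} (h : HasSum (fun k => F k * modeMonomial z k) S) :
    HasSum (fun k => diffMode i j F k * modeMonomial z k) ((z i - z j) * S) := by
  have h1 := (hasSum_shiftMode hz i h).sub (hasSum_shiftMode hz j h)
  rw [← sub_mul] at h1
  refine h1.congr_fun fun k => ?_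
  simp only [diffMode_apply, shiftMode_apply]
  ring

lemma hasSum_diffMode_pow {n : ℕ} {z : Fin n → ℂ} (hz : ∀ t, z t ≠ 0) (i j : Fin n) (N : ℕ)
    {F : (Fin n → ℤ) → ℂ} {S : ℂ} (h : HasSum (fun k => F k * modeMonomial z k) S) :
    HasSum (fun k => (diffMode i j ^ N) F k * modeMonomial z k) ((z i - z j) ^ N * S) := by
  induction N with
  | zero => simpa using h
  | succ N ih =>
    simpa only [pow_succ', Module.End.mul_apply, mul_assoc] using hasSum_diffMode hz i j ih

/-- Along every line in the direction `e_j - e_i` the coefficients of `F` eventually vanish, so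
that `F` can be divided by `z i - z j` in the region `|z i| > |z j|`. -/
def EventuallyZeroAlong {X : Type*} [Zero X] {n : ℕ} (i j : Fin n) (F : (Fin n → ℤ) → X) :
    Prop :=
  ∀ k : Fin n → ℤ, ∃ M : ℕ, ∀ m : ℕ, M ≤ m →
    F (k + Pi.single i (-(m : ℤ)) + Pi.single j (m : ℤ)) = 0

lemma EventuallyZeroAlong.diffMode_apply {X : Type*} [AddCommGroup X] [Module ℂ X] {n : ℕ}
    {i j : Fin n} {F : (Fin n → ℤ) → X} (h : EventuallyZeroAlong i j F) (s t : Fin n) :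
    EventuallyZeroAlong i j (diffMode s t F) := by
  intro k
  obtain ⟨M₁, h₁⟩ := h (k + Pi.single s 1)
  obtain ⟨M₂, h₂⟩ := h (k + Pi.single t 1)
  refine ⟨max M₁ M₂, fun m hm => ?_⟩
  have e : ∀ u : Fin n, k + Pi.single i (-(m : ℤ)) + Pi.single j (m : ℤ) + Pi.single u 1
      = k + Pi.single u 1 + Pi.single i (-(m : ℤ)) + Pi.single j (m : ℤ) := fun u => by abel
  rw [_root_.diffMode_apply, e, e, h₁ m (le_trans (le_max_left _ _) hm),
    h₂ m (le_trans (le_max_right _ _) hm), sub_zero]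

/-- The shear `(k, m) ↦ (k + D m, m)`. -/
def shearEquiv {G ι : Type*} [AddGroup G] (D : ι → G) : G × ι ≃ G × ι where
  toFun p := (p.1 + D p.2, p.2)
  invFun p := (p.1 - D p.2, p.2)
  left_inv p := by simp
  right_inv p := by simp

lemma hasSum_diffMode_line {n : ℕ} {i j : Fin n} {F : (Fin n → ℤ) → ℂ}
    (hF : EventuallyZeroAlong i j F) (k : Fin n → ℤ) :
    HasSum (fun m : ℕ => diffMode i j F (k + Pi.single j (m : ℤ) + Pi.single i (-(m : ℤ) - 1)))
      (F k) := by
  obtain ⟨M, hM⟩ := hF k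
  set g : ℕ → ℂ := fun m => F (k + Pi.single i (-(m : ℤ)) + Pi.single j (m : ℤ)) with hg
  have hsucc : ∀ m : ℕ,
      diffMode i j F (k + Pi.single j (m : ℤ) + Pi.single i (-(m : ℤ) - 1))
        = g m - g (m + 1) := by
    intro m
    have h1 : (Pi.single i (-(m : ℤ)) : Fin n → ℤ)
        = Pi.single i (-(m : ℤ) - 1) + Pi.single i 1 := by
      rw [← Pi.single_add]; congr 1; ring
    have h2 : (Pi.single i (-((m + 1 : ℕ) : ℤ)) : Fin n → ℤ) = Pi.single i (-(m : ℤ) - 1) := by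
      congr 1; push_cast; ring
    have h3 : (Pi.single j (((m + 1 : ℕ) : ℤ)) : Fin n → ℤ)
        = Pi.single j (m : ℤ) + Pi.single j 1 := by
      rw [← Pi.single_add]; congr 1
    rw [diffMode_apply, hg]
    dsimp only
    rw [h1, h2, h3]
    congr 2 <;> (funext t; simp only [Pi.add_apply]; ring)
  have hs : HasSum (fun m : ℕ => g m - g (m + 1)) (∑ m ∈ Finset.range M, (g m - g (m + 1))) :=
    hasSum_sum_of_ne_finset_zero (fun m hm => by
      have hm' : M ≤ m := by simpa using hm
      rw [hg]
      dsimp only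
      rw [hM m hm', hM (m + 1) (by omega), sub_zero])
  rw [Finset.sum_range_sub' g, show g M = 0 from hM M le_rfl, sub_zero,
    show g 0 = F k by simp [hg]] at hs
  simpa only [hsucc] using hs

lemma modeMonomial_add_single_add_single {n : ℕ} {z : Fin n → ℂ} (hz : ∀ t, z t ≠ 0)
    (k : Fin n → ℤ) (i j : Fin n) (m : ℕ) :
    modeMonomial z (k + Pi.single j (m : ℤ) + Pi.single i (-(m : ℤ) - 1)) *
      ((z i)⁻¹ * (z j / z i) ^ m) = modeMonomial z k := by
  have h1 : z i ^ (-(-(m : ℤ) - 1)) = z i ^ m * z i := by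
    rw [neg_sub, sub_neg_eq_add, add_comm, zpow_add₀ (hz i), zpow_natCast, zpow_one]
  rw [modeMonomial_add_single hz, modeMonomial_add_single hz, h1, zpow_neg, zpow_natCast,
    div_pow]
  have := hz i
  have := hz j
  field_simp

lemma hasSum_of_hasSum_diffMode {n : ℕ} {z : Fin n → ℂ} (hz : ∀ t, z t ≠ 0) {i j : Fin n}
    (hij : ‖z j‖ < ‖z i‖) {F : (Fin n → ℤ) → ℂ} (hF : EventuallyZeroAlong i j F) {S : ℂ}
    (h : HasSum (fun k => diffMode i j F k * modeMonomial z k) ((z i - z j) * S)) :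
    HasSum (fun k => F k * modeMonomial z k) S := by
  have hq : ‖z j / z i‖ < 1 := by
    rw [norm_div, div_lt_one (norm_pos_iff.mpr (hz i))]
    exact hij
  have hg : HasSum (fun m : ℕ => (z i)⁻¹ * (z j / z i) ^ m) ((z i)⁻¹ * (1 - z j / z i)⁻¹) :=
    (hasSum_geometric_of_norm_lt_one hq).mul_left (z i)⁻¹
  have hsum : Summable fun p : (Fin n → ℤ) × ℕ =>
      diffMode i j F p.1 * modeMonomial z p.1 * ((z i)⁻¹ * (z j / z i) ^ p.2) :=
    summable_mul_of_summable_norm (f := fun k => diffMode i j F k * modeMonomial z k)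
      (g := fun m : ℕ => (z i)⁻¹ * (z j / z i) ^ m) h.summable.norm hg.summable.norm
  have hprod := h.mul hg hsum
  have hne : z i - z j ≠ 0 := by
    intro h0
    rw [sub_eq_zero.mp h0] at hij
    exact lt_irrefl _ hij
  have hS : (z i - z j) * S * ((z i)⁻¹ * (1 - z j / z i)⁻¹) = S := by
    have := hz i
    have h1 : (1 - z j / z i) = (z i - z j) / z i := by field_simp
    rw [h1]
    field_simp
  rw [hS] at hprod
  have h2 := (shearEquiv fun m : ℕ =>
    (Pi.single j (m : ℤ) + Pi.single i (-(m : ℤ) - 1) : Fin n → ℤ)).hasSum_iff.mpr hprod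
  have h3 : HasSum (fun p : (Fin n → ℤ) × ℕ =>
      diffMode i j F (p.1 + Pi.single j (p.2 : ℤ) + Pi.single i (-(p.2 : ℤ) - 1)) *
        modeMonomial z p.1) S := by
    refine h2.congr_fun fun p => ?_
    rw [← modeMonomial_add_single_add_single hz p.1 i j p.2]
    simp only [Function.comp_apply, shearEquiv, Equiv.coe_fn_mk, ← add_assoc, mul_assoc]
  have h4 : ∀ k : Fin n → ℤ, HasSum (fun m : ℕ =>
      diffMode i j F (k + Pi.single j (m : ℤ) + Pi.single i (-(m : ℤ) - 1)) *
        modeMonomial z k) (F k * modeMonomial z k) :=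
    fun k => (hasSum_diffMode_line hF k).mul_right (modeMonomial z k)
  exact HasSum.prod_fiberwise h3 h4

lemma hasSum_of_hasSum_diffMode_pow {n : ℕ} {z : Fin n → ℂ} (hz : ∀ t, z t ≠ 0) {i j : Fin n}
    (hij : ‖z j‖ < ‖z i‖) (N : ℕ) {F : (Fin n → ℤ) → ℂ} (hF : EventuallyZeroAlong i j F) {S : ℂ}
    (h : HasSum (fun k => (diffMode i j ^ N) F k * modeMonomial z k) ((z i - z j) ^ N * S)) :
    HasSum (fun k => F k * modeMonomial z k) S := by
  induction N generalizing F S with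
  | zero => simpa using h
  | succ N ih =>
    refine hasSum_of_hasSum_diffMode hz hij hF (ih (hF.diffMode_apply i j) ?_)
    simpa only [pow_succ, Module.End.mul_apply, mul_assoc] using h

/-! ## Uniqueness of Laurent expansions -/

open MeasureTheory in
lemma eq_zero_of_hasSum_mul_zpow {c : ℤ → ℂ}
    (h : ∀ u : ℂ, ‖u‖ = 1 → HasSum (fun n => c n * u ^ n) 0) (k : ℤ) : c k = 0 := by
  have hc : Summable fun n => ‖c n‖ := by simpa using (h 1 (by simp)).summable.norm
  have hu : ∀ θ : ℝ, ‖Complex.exp (θ * Complex.I)‖ = 1 := Complex.norm_exp_ofReal_mul_I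
  have hpow : ∀ (n : ℤ) (θ : ℝ), c n * Complex.exp (θ * Complex.I) ^ n *
      Complex.exp (θ * Complex.I) ^ (-k) = c n * Complex.exp (((n - k : ℤ) * Complex.I) * θ) := by
    intro n θ
    rw [mul_assoc, ← zpow_add₀ (Complex.exp_ne_zero _), ← Complex.exp_int_mul]
    congr 2
    push_cast
    ring
  have hsum := intervalIntegral.hasSum_integral_of_dominated_convergence (μ := volume)
    (a := 0) (b := 2 * Real.pi) (f := fun _ => (0 : ℂ))
    (F := fun (n : ℤ) (θ : ℝ) => c n * Complex.exp (((n - k : ℤ) * Complex.I) * θ))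
    (fun n _ => ‖c n‖)
    (fun n => (by fun_prop : Continuous fun θ : ℝ =>
      c n * Complex.exp (((n - k : ℤ) * Complex.I) * θ)).aestronglyMeasurable)
    (fun n => Filter.Eventually.of_forall fun θ _ => by
      rw [← hpow]
      simp [hu])
    (Filter.Eventually.of_forall fun θ _ => hc)
    (by simp)
    (Filter.Eventually.of_forall fun θ _ => by
      simpa only [hpow, zero_mul] using
        (h _ (hu θ)).mul_right (Complex.exp (θ * Complex.I) ^ (-k)))
  have hint : ∀ n : ℤ, ∫ θ in (0 : ℝ)..(2 * Real.pi),
      c n * Complex.exp (((n - k : ℤ) * Complex.I) * θ)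
        = if n = k then c k * (2 * Real.pi : ℝ) else 0 := by
    intro n
    split_ifs with hn
    · subst hn
      simp [mul_comm]
    · have hne : ((n - k : ℤ) : ℂ) * Complex.I ≠ 0 :=
        mul_ne_zero (by exact_mod_cast sub_ne_zero.mpr hn) Complex.I_ne_zero
      have he : Complex.exp (((n - k : ℤ) : ℂ) * Complex.I * ((2 * Real.pi : ℝ) : ℂ)) = 1 := by
        rw [← Complex.exp_int_mul_two_pi_mul_I (n - k)]
        congr 1
        push_cast
        ring
      rw [intervalIntegral.integral_const_mul, integral_exp_mul_complex hne, he]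
      simp
  simp only [hint, intervalIntegral.integral_zero] at hsum
  have := (hasSum_ite_eq k (c k * (2 * Real.pi : ℝ))).unique hsum
  simpa [Real.pi_ne_zero] using this

/-- A formal Laurent series in two variables which converges to `0` on a torus vanishes. -/
lemma eq_zero_of_hasSum_modeMonomial {r₀ r₁ : ℝ} (hr₀ : 0 < r₀) (hr₁ : 0 < r₁)
    {F : (Fin 2 → ℤ) → ℂ}
    (h : ∀ z : Fin 2 → ℂ, ‖z 0‖ = r₀ → ‖z 1‖ = r₁ →
      HasSum (fun k => F k * modeMonomial z k) 0) : F = 0 := by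
  let e : ℤ × ℤ ≃ (Fin 2 → ℤ) :=
    ((Equiv.subLeft (-1)).prodCongr (Equiv.subLeft (-1))).trans (finTwoArrowEquiv ℤ).symm
  have hr₀' : (r₀ : ℂ) ≠ 0 := by exact_mod_cast hr₀.ne'
  have hr₁' : (r₁ : ℂ) ≠ 0 := by exact_mod_cast hr₁.ne'
  set c : ℤ × ℤ → ℂ := fun p => F (e p) * r₀ ^ p.1 * r₁ ^ p.2 with hc
  have h1 : ∀ x y : ℂ, ‖x‖ = 1 → ‖y‖ = 1 → HasSum (fun p => c p * x ^ p.1 * y ^ p.2) 0 := by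
    intro x y hx hy
    have h2 := e.hasSum_iff.mpr (h ![r₀ * x, r₁ * y] (by simp [hx, hr₀.le]) (by simp [hy, hr₁.le]))
    refine h2.congr_fun fun p => ?_
    have : modeMonomial ![r₀ * x, r₁ * y] (e p)
        = (r₀ * x) ^ p.1 * (r₁ * y) ^ p.2 := by
      simp [modeMonomial, e, Fin.prod_univ_two]
    rw [Function.comp_apply, this, mul_zpow, mul_zpow]
    ring
  have h2 : ∀ (y : ℂ), ‖y‖ = 1 → ∀ n : ℤ, HasSum (fun m => c (n, m) * y ^ m) 0 := by
    intro y hy n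
    have hs : ∀ n, Summable fun m => c (n, m) * y ^ m := by
      intro n
      simpa using (h1 1 y (by simp) hy).summable.prod_factor n
    have h3 : ∀ x : ℂ, ‖x‖ = 1 → HasSum (fun n => (∑' m, c (n, m) * y ^ m) * x ^ n) 0 := by
      intro x hx
      refine (h1 x y hx hy).prod_fiberwise fun n => ?_
      refine ((hs n).hasSum.mul_right (x ^ n)).congr_fun fun m => ?_
      ring
    have h4 := eq_zero_of_hasSum_mul_zpow h3 n
    have h5 := (hs n).hasSum
    rwa [h4] at h5
  funext k
  have h3 := eq_zero_of_hasSum_mul_zpow (fun y hy => h2 y hy (e.symm k).1) (e.symm k).2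
  simpa [hc, hr₀', hr₁', zpow_ne_zero] using h3

/-- The Laurent expansion of a rational function with poles only on the coordinate hyperplanes. -/
lemma exists_hasSum_modeMonomial {n : ℕ} (P : MvPolynomial (Fin n) ℂ) (N : ℕ) :
    ∃ q : (Fin n → ℤ) → ℂ, ∀ z : Fin n → ℂ, (∀ t, z t ≠ 0) →
      HasSum (fun k => q k * modeMonomial z k) (MvPolynomial.eval z P / ∏ t, z t ^ N) := by
  refine ⟨fun k => ∑ d ∈ P.support,
    if k = (fun t => (N : ℤ) - d t - 1) then P.coeff d else 0, fun z hz => ?_⟩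
  have h1 : ∀ d ∈ P.support, HasSum (fun k : Fin n → ℤ =>
      (if k = (fun t => (N : ℤ) - d t - 1) then P.coeff d else 0) * modeMonomial z k)
      (P.coeff d * ∏ t, z t ^ d t / z t ^ N) := by
    intro d _
    have h2 := hasSum_single (f := fun k : Fin n → ℤ =>
      (if k = (fun t => (N : ℤ) - d t - 1) then P.coeff d else 0) * modeMonomial z k)
      (fun t => (N : ℤ) - d t - 1) (fun k hk => by simp [hk])
    convert h2 using 1
    simp only [if_true, modeMonomial]
    congr 1
    refine Finset.prod_congr rfl fun t _ => ?_
    rw [← zpow_natCast, ← zpow_natCast, ← zpow_sub₀ (hz t)]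
    congr 1
    ring
  have h2 := hasSum_sum h1
  simp only [← Finset.sum_mul] at h2
  convert h2 using 1
  rw [MvPolynomial.eval_eq', Finset.sum_div]
  refine Finset.sum_congr rfl fun d _ => ?_
  rw [Finset.prod_div_distrib, mul_div_assoc]

/-! ## Pole orders from iterates -/

lemma X_sub_X_dvd {P : MvPolynomial (Fin 2) ℂ}
    (h : ∀ y : ℂ, y ≠ 0 → MvPolynomial.eval ![y, y] P = 0) :
    (MvPolynomial.X 0 - MvPolynomial.X 1 : MvPolynomial (Fin 2) ℂ) ∣ P := by
  set I : Ideal (MvPolynomial (Fin 2) ℂ) :=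
    Ideal.span {MvPolynomial.X 0 - MvPolynomial.X 1} with hI
  rw [← Ideal.mem_span_singleton, ← hI, ← Ideal.Quotient.eq_zero_iff_mem]
  set Q : MvPolynomial (Fin 2) ℂ := MvPolynomial.aeval (fun _ => MvPolynomial.X 1) P with hQ
  have hQ0 : MvPolynomial.X 1 * Q = 0 := by
    refine MvPolynomial.funext fun x => ?_
    by_cases hx : x 1 = 0
    · simp [hx]
    · have : MvPolynomial.eval x Q = MvPolynomial.eval ![x 1, x 1] P := by
        have hcomp : (MvPolynomial.aeval x).comp (MvPolynomial.aeval fun _ => MvPolynomial.X 1)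
            = (MvPolynomial.aeval ![x 1, x 1] : MvPolynomial (Fin 2) ℂ →ₐ[ℂ] ℂ) := by
          refine MvPolynomial.algHom_ext fun i => ?_
          fin_cases i <;> simp
        exact congrArg (fun φ => φ P) hcomp
      simp [this, h _ hx]
  have hQ1 : Q = 0 := (mul_eq_zero.mp hQ0).resolve_left (MvPolynomial.X_ne_zero 1)
  have key : (Ideal.Quotient.mkₐ ℂ I) = (Ideal.Quotient.mkₐ ℂ I).comp
      (MvPolynomial.aeval (fun _ => MvPolynomial.X 1)) := by
    refine MvPolynomial.algHom_ext fun i => ?_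
    have h01 : Ideal.Quotient.mk I (MvPolynomial.X 0) = Ideal.Quotient.mk I (MvPolynomial.X 1) :=
      Ideal.Quotient.eq.mpr (Ideal.mem_span_singleton_self _)
    fin_cases i <;> simp [h01]
  have h0 : Ideal.Quotient.mkₐ ℂ I P = Ideal.Quotient.mkₐ ℂ I Q := congrArg (fun φ => φ P) key
  rw [hQ1, map_zero] at h0
  exact h0

open Filter Topology in
lemma eval_diagonal_eq_zero {c : ℤ × ℤ → ℂ} {f : (Fin 2 → ℂ) → ℂ} {N : ℕ}
    (hc : ∀ k : ℤ × ℤ, (N : ℤ) ≤ k.1 → c k = 0)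
    (hf : ∀ z₁ z₂ : ℂ, ‖z₂‖ > ‖z₁ - z₂‖ → z₁ ≠ z₂ → z₂ ≠ 0 →
      HasSum (fun k : ℤ × ℤ => c k * (z₁ - z₂) ^ (-k.1 - 1) * z₂ ^ (-k.2 - 1)) (f ![z₁, z₂]))
    {P : MvPolynomial (Fin 2) ℂ} {M L : ℕ} (hNL : N < L)
    (hP : ∀ x y : ℂ, x ≠ 0 → y ≠ 0 → x ≠ y →
      f ![x, y] * (x ^ M * y ^ M * (x - y) ^ L) = MvPolynomial.eval ![x, y] P)
    {y : ℂ} (hy : y ≠ 0) : MvPolynomial.eval ![y, y] P = 0 := by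
  have hy' : 0 < ‖y‖ := norm_pos_iff.mpr hy
  set r : ℝ := ‖y‖ / 2 with hr
  have hr0 : 0 < r := by positivity
  have hrn : ‖(r : ℂ)‖ = r := by simp [hr0.le]
  have hB := (hf (y + r) y (by simp only [add_sub_cancel_left, hrn]; linarith)
    (by simp [hr0.ne']) hy).summable.norm.hasSum
  simp only [add_sub_cancel_left] at hB
  set B : ℝ := ∑' k : ℤ × ℤ, ‖c k * (r : ℂ) ^ (-k.1 - 1) * y ^ (-k.2 - 1)‖ with hBdef
  have hbound : ∀ x : ℂ, x ≠ 0 → ‖x‖ < r → ‖f ![y + x, y] * x ^ N‖ ≤ B * r ^ N := by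
    intro x hx hxr
    have h1 := (hf (y + x) y (by simp; linarith) (by simp [hx]) hy).mul_right (x ^ N)
    simp only [add_sub_cancel_left] at h1
    refine h1.norm_le_of_bounded (hB.mul_right (r ^ N)) fun k => ?_
    by_cases hk : (N : ℤ) ≤ k.1
    · simp [hc k hk]
    · obtain ⟨a, ha⟩ := Int.eq_ofNat_of_zero_le (show 0 ≤ (N : ℤ) - 1 - k.1 by omega)
      have hpow : ∀ t : ℂ, t ≠ 0 → t ^ (-k.1 - 1) * t ^ N = t ^ a := by
        intro t ht
        rw [← zpow_natCast, ← zpow_natCast, ← zpow_add₀ ht, ← ha]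
        congr 1
        ring
      have hrC : (r : ℂ) ≠ 0 := by exact_mod_cast hr0.ne'
      have e1 : ‖c k * x ^ (-k.1 - 1) * y ^ (-k.2 - 1) * x ^ N‖
          = ‖c k‖ * ‖y ^ (-k.2 - 1)‖ * ‖x‖ ^ a := by
        rw [← norm_pow, ← hpow x hx]
        simp only [norm_mul]
        ring
      have e2 : ‖c k * (r : ℂ) ^ (-k.1 - 1) * y ^ (-k.2 - 1)‖ * r ^ N
          = ‖c k‖ * ‖y ^ (-k.2 - 1)‖ * r ^ a := by
        have : r ^ a = ‖(r : ℂ) ^ (-k.1 - 1)‖ * r ^ N := by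
          rw [← hrn, ← norm_pow, ← norm_pow, ← norm_mul, hrn, hpow _ hrC]
        rw [this]
        simp only [norm_mul]
        ring
      rw [e1, e2]
      gcongr
  have hcont : Tendsto (fun x : ℂ => MvPolynomial.eval ![y + x, y] P) (𝓝[≠] 0)
      (𝓝 (MvPolynomial.eval ![y, y] P)) := by
    have h1 : Continuous fun x : ℂ => MvPolynomial.eval ![y + x, y] P := by
      refine (MvPolynomial.continuous_eval P).comp (continuous_pi fun i => ?_)
      fin_cases i <;> simp <;> fun_prop
    have h2 := (h1.tendsto 0).mono_left (nhdsWithin_le_nhds (s := {0}ᶜ))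
    simpa using h2
  refine tendsto_nhds_unique hcont (squeeze_zero_norm'
    (a := fun x : ℂ => B * r ^ N * (2 * ‖y‖) ^ M * ‖y‖ ^ M * ‖x‖ ^ (L - N)) ?_ ?_)
  · have hball : ∀ᶠ x : ℂ in 𝓝[≠] 0, ‖x‖ < r := by
      refine nhdsWithin_le_nhds ?_
      filter_upwards [Metric.ball_mem_nhds (0 : ℂ) hr0] with x hx
      simpa using hx
    filter_upwards [hball, self_mem_nhdsWithin] with x hxr hx
    have hx0 : x ≠ 0 := hx
    have hyx : y + x ≠ 0 := by
      intro h0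
      have : ‖x‖ = ‖y‖ := by rw [eq_neg_of_add_eq_zero_right h0, norm_neg]
      linarith
    rw [← hP (y + x) y hyx hy (by simp [hx0]), add_sub_cancel_left]
    have e1 : f ![y + x, y] * ((y + x) ^ M * y ^ M * x ^ L)
        = (f ![y + x, y] * x ^ N) * (y + x) ^ M * y ^ M * x ^ (L - N) := by
      have : x ^ L = x ^ N * x ^ (L - N) := by rw [← pow_add]; congr 1; omega
      rw [this]; ring
    rw [e1]
    simp only [norm_mul (_ * _), norm_pow]
    have hyx2 : ‖y + x‖ ≤ 2 * ‖y‖ := (norm_add_le _ _).trans (by linarith)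
    have hB0 : 0 ≤ B := tsum_nonneg fun _ => norm_nonneg _
    gcongr
    exact hbound x hx0 hxr
  · have h1 : Tendsto (fun x : ℂ => ‖x‖ ^ (L - N)) (𝓝[≠] 0) (𝓝 0) := by
      have h2 : Continuous fun x : ℂ => ‖x‖ ^ (L - N) := by fun_prop
      have h3 := (h2.tendsto 0).mono_left (nhdsWithin_le_nhds (s := {0}ᶜ))
      simpa [show L - N ≠ 0 by omega] using h3
    simpa using h1.const_mul (B * r ^ N * (2 * ‖y‖) ^ M * ‖y‖ ^ M)

/-- The order of the pole at `z 0 = z 1` is bounded by the order of truncation of the expansion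
in powers of `z 0 - z 1`. -/
lemma exists_pole_order_le {c : ℤ × ℤ → ℂ} {f : (Fin 2 → ℂ) → ℂ} {N : ℕ}
    (hc : ∀ k : ℤ × ℤ, (N : ℤ) ≤ k.1 → c k = 0) (hfull : RatFull 2 f)
    (hf : ∀ z₁ z₂ : ℂ, ‖z₂‖ > ‖z₁ - z₂‖ → z₁ ≠ z₂ → z₂ ≠ 0 →
      HasSum (fun k : ℤ × ℤ => c k * (z₁ - z₂) ^ (-k.1 - 1) * z₂ ^ (-k.2 - 1)) (f ![z₁, z₂])) :
    ∃ (Q : MvPolynomial (Fin 2) ℂ) (M : ℕ), ∀ x y : ℂ, x ≠ 0 → y ≠ 0 → x ≠ y →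
      f ![x, y] * (x ^ M * y ^ M * (x - y) ^ N) = MvPolynomial.eval ![x, y] Q := by
  obtain ⟨P, M, hP⟩ := hfull
  have hP' : ∀ x y : ℂ, x ≠ 0 → y ≠ 0 → x ≠ y →
      f ![x, y] * (x ^ M * y ^ M * (x - y) ^ M) = MvPolynomial.eval ![x, y] P := by
    intro x y hx hy hxy
    have := hP ![x, y] (by intro i; fin_cases i <;> simpa)
      (by intro i j hij; fin_cases i <;> fin_cases j <;> simp_all [eq_comm])
    simpa [Fin.prod_univ_two] using this
  have hstep : ∀ (d : ℕ) (P : MvPolynomial (Fin 2) ℂ),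
      (∀ x y : ℂ, x ≠ 0 → y ≠ 0 → x ≠ y →
        f ![x, y] * (x ^ M * y ^ M * (x - y) ^ (N + d)) = MvPolynomial.eval ![x, y] P) →
      ∃ Q : MvPolynomial (Fin 2) ℂ, ∀ x y : ℂ, x ≠ 0 → y ≠ 0 → x ≠ y →
        f ![x, y] * (x ^ M * y ^ M * (x - y) ^ N) = MvPolynomial.eval ![x, y] Q := by
    intro d
    induction d with
    | zero => exact fun P h => ⟨P, h⟩
    | succ d ih =>
      intro P h
      obtain ⟨Q, rfl⟩ := X_sub_X_dvd fun y hy =>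
        eval_diagonal_eq_zero hc hf (by omega : N < N + (d + 1)) h hy
      refine ih Q fun x y hx hy hxy => ?_
      have h1 := h x y hx hy hxy
      refine mul_left_cancel₀ (sub_ne_zero.mpr hxy) ?_
      simp only [map_mul, map_sub, MvPolynomial.eval_X, Matrix.cons_val_zero,
        Matrix.cons_val_one] at h1
      rw [← h1]
      ring
  obtain ⟨Q, hQ⟩ := hstep M (P * (MvPolynomial.X 0 - MvPolynomial.X 1) ^ N) (by
    intro x y hx hy hxy
    simp only [map_mul, map_sub, map_pow, MvPolynomial.eval_X, Matrix.cons_val_zero,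
      Matrix.cons_val_one]
    rw [← hP' x y hx hy hxy]
    ring)
  exact ⟨Q, M, hQ⟩

/-! ## Weak commutativity -/

lemma map_diffMode_pow {X Y : Type*} [AddCommGroup X] [Module ℂ X] [AddCommGroup Y] [Module ℂ Y]
    {n : ℕ} (φ : X →ₗ[ℂ] Y) (i j : Fin n) (N : ℕ) (F : (Fin n → ℤ) → X) :
    (diffMode i j ^ N) (fun k => φ (F k)) = fun k => φ ((diffMode i j ^ N) F k) := by
  induction N with
  | zero => simp
  | succ N ih =>
    funext k
    rw [pow_succ' (diffMode i j) N, pow_succ' (diffMode i j) N, Module.End.mul_apply, ih]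
    simp [Module.End.mul_apply, diffMode_apply]

lemma eq_zero_of_gradedFunctional {A : GRVA V} (M : GRMod V W A) {x : W}
    (h : ∀ w' : W →ₗ[ℂ] ℂ, GradedFunctionalC M.grading w' → w' x = 0) : x = 0 := by
  have := M.decomp
  refine (DirectSum.decomposeLinearEquiv M.grading).map_eq_zero_iff.mp ?_
  refine DFinsupp.ext fun c => ?_
  refine (Module.forall_dual_apply_eq_zero_iff ℂ _).mp fun φ => ?_
  refine h (φ ∘ₗ DirectSum.component ℂ ℂ _ c ∘ₗ
    (DirectSum.decomposeLinearEquiv M.grading).toLinearMap) ?_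
  refine (Set.finite_singleton c).subset ?_
  rintro c' ⟨w, hw, hne⟩
  by_contra hcc
  refine hne ?_
  have h0 : DirectSum.decompose M.grading w c = 0 :=
    Subtype.ext (DirectSum.decompose_of_mem_ne M.grading hw hcc)
  change φ (DirectSum.decompose M.grading w c) = 0
  rw [h0, map_zero]

lemma hasSum_fin_two_iff {F : (Fin 2 → ℤ) → ℂ} {z : Fin 2 → ℂ} {S : ℂ} :
    HasSum (fun k => F k * modeMonomial z k) S ↔
      HasSum (fun k : ℤ × ℤ => F ![k.1, k.2] * z 0 ^ (-k.1 - 1) * z 1 ^ (-k.2 - 1)) S := by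
  rw [← (finTwoArrowEquiv ℤ).symm.hasSum_iff]
  refine iff_of_eq (congrArg (HasSum · S) (funext fun k => ?_))
  simp [modeMonomial, Fin.prod_univ_two, mul_assoc]

/-- Weak commutativity: `(x₁ - x₂)^N [Y(u₁, x₁), Y(u₂, x₂)] = 0`, where `N` depends only on
`u₁` and `u₂`. -/
lemma weak_commutativity {A : GRVA V} (M : GRMod V W A) (u₁ u₂ : V) :
    ∃ N : ℕ, ∀ w : W, (diffMode 0 1 ^ N) (fun k : Fin 2 → ℤ =>
      M.Y u₁ (M.Y u₂ w (k 1)) (k 0) - M.Y u₂ (M.Y u₁ w (k 0)) (k 1)) = 0 := by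
  obtain ⟨N₀, hN₀⟩ := A.trunc u₁ u₂
  refine ⟨N₀.toNat, fun w => funext fun k => eq_zero_of_gradedFunctional M fun w' hw' => ?_⟩
  set N := N₀.toNat with hN
  obtain ⟨f, hfull, h₁₂, h₂₁, hit⟩ := M.duality u₁ u₂ w w' hw'
  obtain ⟨Q, B, hQ⟩ := exists_pole_order_le (N := N) (fun k hk => by
    rw [hN₀ k.1 (by omega)]
    simp) hfull hit
  obtain ⟨q, hq⟩ := exists_hasSum_modeMonomial Q B
  have hval : ∀ z : Fin 2 → ℂ, z 0 ≠ 0 → z 1 ≠ 0 → z 0 ≠ z 1 →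
      MvPolynomial.eval z Q / ∏ t, z t ^ B = (z 0 - z 1) ^ N * f ![z 0, z 1] := by
    intro z h0 h1 h01
    have hz : z = ![z 0, z 1] := by funext i; fin_cases i <;> rfl
    rw [Fin.prod_univ_two, div_eq_iff (by positivity)]
    conv_lhs => rw [hz]
    rw [← hQ _ _ h0 h1 h01]
    ring
  set a : (Fin 2 → ℤ) → ℂ := fun k => w' (M.Y u₁ (M.Y u₂ w (k 1)) (k 0)) with ha
  set b : (Fin 2 → ℤ) → ℂ := fun k => w' (M.Y u₂ (M.Y u₁ w (k 0)) (k 1)) with hb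
  have key : ∀ (F : (Fin 2 → ℤ) → ℂ) (r₀ r₁ : ℝ), 0 < r₀ → 0 < r₁ → r₀ ≠ r₁ →
      (∀ z : Fin 2 → ℂ, ‖z 0‖ = r₀ → ‖z 1‖ = r₁ →
        HasSum (fun k => F k * modeMonomial z k) (f ![z 0, z 1])) →
      (diffMode 0 1 ^ N) F = q := by
    intro F r₀ r₁ hr₀ hr₁ hr hF
    refine sub_eq_zero.mp (eq_zero_of_hasSum_modeMonomial hr₀ hr₁ fun z h0 h1 => ?_)
    have hz0 : z 0 ≠ 0 := norm_pos_iff.mp (h0 ▸ hr₀)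
    have hz1 : z 1 ≠ 0 := norm_pos_iff.mp (h1 ▸ hr₁)
    have hz : ∀ t, z t ≠ 0 := by intro t; fin_cases t <;> assumption
    have hne : z 0 ≠ z 1 := fun h => hr (by rw [← h0, ← h1, h])
    have h2 := (hasSum_diffMode_pow hz 0 1 N (hF z h0 h1)).sub (hq z hz)
    rw [hval z hz0 hz1 hne, sub_self] at h2
    simpa only [Pi.sub_apply, sub_mul] using h2
  have hka : (diffMode 0 1 ^ N) a = q := key a 2 1 (by norm_num) (by norm_num) (by norm_num)
    fun z h0 h1 => hasSum_fin_two_iff.mpr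
      (h₁₂ (z 0) (z 1) (by rw [h0, h1]; norm_num) (norm_pos_iff.mp (by rw [h1]; norm_num)))
  have hkb : (diffMode 0 1 ^ N) b = q := key b 1 2 (by norm_num) (by norm_num) (by norm_num)
    fun z h0 h1 => hasSum_fin_two_iff.mpr
      (h₂₁ (z 0) (z 1) (by rw [h0, h1]; norm_num) (norm_pos_iff.mp (by rw [h0]; norm_num)))
  have hsub := congrFun (map_diffMode_pow w' 0 1 N (fun k : Fin 2 → ℤ =>
      M.Y u₁ (M.Y u₂ w (k 1)) (k 0) - M.Y u₂ (M.Y u₁ w (k 0)) (k 1))) k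
  rw [← hsub]
  have hab : (fun k : Fin 2 → ℤ =>
      w' (M.Y u₁ (M.Y u₂ w (k 1)) (k 0) - M.Y u₂ (M.Y u₁ w (k 0)) (k 1))) = a - b := by
    funext k
    simp [ha, hb]
  rw [hab, map_sub, hka, hkb, sub_self]
  rfl

/-! ## Weights -/

lemma GRMod.Y_mem {A : GRVA V} (M : GRMod V W A) {m : ℤ} {c : ℂ} {u : V} {w : W}
    (hu : u ∈ A.grading m) (hw : w ∈ M.grading c) (k : ℤ) :
    M.Y u w k ∈ M.grading (c + m - k - 1) := by
  have := M.decomp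
  set μ : ℂ := c + m - k - 1 with hμ
  have hstep : ∀ x : W, (M.L0 - μ • 1) (M.Y u x k) = M.Y u ((M.L0 - c • 1) x) k := by
    intro x
    have h1 := M.L0_bracket u x k
    rw [A.L0_eq m u hu] at h1
    simp only [LinearMap.sub_apply, LinearMap.smul_apply, Module.End.one_apply, map_sub, map_smul,
      Pi.sub_apply, Pi.smul_apply, h1, hμ]
    push_cast
    module
  have hpow : ∀ (K : ℕ) (x : W),
      ((M.L0 - μ • 1) ^ K) (M.Y u x k) = M.Y u (((M.L0 - c • 1) ^ K) x) k := by
    intro K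
    induction K with
    | zero => simp
    | succ K ih =>
      intro x
      rw [pow_succ, pow_succ, Module.End.mul_apply, Module.End.mul_apply, hstep, ih]
  have hgen : ∀ c', M.grading c' ≤ M.L0.maxGenEigenspace c' := fun c' x hx =>
    (Module.End.mem_maxGenEigenspace _ _ _).mpr (M.L0_nilpotent c' x hx)
  set x := M.Y u w k with hx
  have hxμ : x ∈ M.L0.maxGenEigenspace μ := by
    obtain ⟨K, hK⟩ := M.L0_nilpotent c w hw
    exact (Module.End.mem_maxGenEigenspace _ _ _).mpr ⟨K, by rw [hx, hpow, hK]; simp⟩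
  have hdiff : x - (DirectSum.decompose M.grading x μ : W)
      ∈ ⨆ (c' : ℂ) (_ : c' ≠ μ), M.L0.maxGenEigenspace c' := by
    have hsum := DirectSum.sum_support_decompose M.grading x
    have : x - (DirectSum.decompose M.grading x μ : W)
        = ∑ i ∈ (DirectSum.decompose M.grading x).support.erase μ,
          (DirectSum.decompose M.grading x i : W) := by
      rw [sub_eq_iff_eq_add]
      conv_lhs => rw [← hsum]
      by_cases hmem : μ ∈ (DirectSum.decompose M.grading x).support
      · rw [Finset.sum_erase_add _ _ hmem]
      · rw [Finset.erase_eq_of_notMem hmem]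
        have : DirectSum.decompose M.grading x μ = 0 := by simpa using hmem
        rw [this]
        simp
    rw [this]
    refine Submodule.sum_mem _ fun i hi => ?_
    exact Submodule.mem_iSup_of_mem i (Submodule.mem_iSup_of_mem (Finset.ne_of_mem_erase hi)
      (hgen i (DirectSum.decompose M.grading x i).2))
  have h0 := Submodule.disjoint_def.mp (Module.End.independent_maxGenEigenspace M.L0 μ) _
    (Submodule.sub_mem _ hxμ (hgen μ (DirectSum.decompose M.grading x μ).2)) hdiff
  rw [sub_eq_zero.mp h0]
  exact (DirectSum.decompose M.grading x μ).2

/-- The sum of the homogeneous subspaces whose weights have real part at least `r`. -/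
def GRMod.weightGE {A : GRVA V} (M : GRMod V W A) (r : ℝ) : Submodule ℂ W :=
  ⨆ (c : ℂ) (_ : r ≤ c.re), M.grading c

lemma GRMod.grading_le_weightGE {A : GRVA V} (M : GRMod V W A) {r : ℝ} {c : ℂ} (h : r ≤ c.re) :
    M.grading c ≤ M.weightGE r :=
  le_iSup₂_of_le c h le_rfl

lemma GRMod.weightGE_antitone {A : GRVA V} (M : GRMod V W A) : Antitone M.weightGE :=
  fun _ _ h => iSup₂_le fun _ hc => M.grading_le_weightGE (h.trans hc)

lemma GRMod.exists_mem_weightGE {A : GRVA V} (M : GRMod V W A) :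
    ∃ r : ℝ, ∀ w : W, w ∈ M.weightGE r := by
  have := M.decomp
  obtain ⟨r, hr⟩ := M.lower_trunc
  refine ⟨r, fun w => ?_⟩
  rw [← DirectSum.sum_support_decompose M.grading w]
  refine Submodule.sum_mem _ fun c _ => ?_
  by_cases hc : c.re < r
  · have h0 := (hr c hc).le (DirectSum.decompose M.grading w c).2
    rw [Submodule.mem_bot] at h0
    rw [h0]
    exact Submodule.zero_mem _
  · exact M.grading_le_weightGE (not_lt.mp hc) (DirectSum.decompose M.grading w c).2

lemma GRMod.exists_Y_mem_weightGE {A : GRVA V} (M : GRMod V W A) (u : V) :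
    ∃ d : ℝ, ∀ (r : ℝ) (k : ℤ) (w : W), w ∈ M.weightGE r →
      M.Y u w k ∈ M.weightGE (r + d - k) := by
  have := A.decomp
  refine DirectSum.Decomposition.inductionOn A.grading
    (motive := fun u => ∃ d : ℝ, ∀ (r : ℝ) (k : ℤ) (w : W), w ∈ M.weightGE r →
      M.Y u w k ∈ M.weightGE (r + d - k)) ⟨0, fun r k w _ => by simp⟩ ?_ ?_ u
  · intro m u
    refine ⟨m - 1, fun r k w hw => ?_⟩
    have hle : M.weightGE r ≤
        (M.weightGE (r + (m - 1) - k)).comap (LinearMap.proj k ∘ₗ M.Y (u : V)) := by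
      refine iSup₂_le fun c hc x hx => ?_
      refine M.grading_le_weightGE ?_ (M.Y_mem u.2 hx k)
      simp
      linarith
    exact hle hw
  · rintro u₁ u₂ ⟨d₁, h₁⟩ ⟨d₂, h₂⟩
    refine ⟨min d₁ d₂, fun r k w hw => ?_⟩
    rw [map_add]
    refine Submodule.add_mem _ (M.weightGE_antitone ?_ (h₁ r k w hw))
      (M.weightGE_antitone ?_ (h₂ r k w hw))
    · linarith [min_le_left d₁ d₂]
    · linarith [min_le_right d₁ d₂]

lemma GRMod.exists_eq_zero_of_mem_weightGE {A : GRVA V} (M : GRMod V W A) {w' : W →ₗ[ℂ] ℂ}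
    (hw' : GradedFunctionalC M.grading w') :
    ∃ r : ℝ, ∀ w ∈ M.weightGE r, w' w = 0 := by
  obtain ⟨B, hB⟩ := (hw'.image Complex.re).bddAbove
  refine ⟨B + 1, fun w hw => ?_⟩
  have hle : M.weightGE (B + 1) ≤ LinearMap.ker w' := by
    refine iSup₂_le fun c hc x hx => ?_
    by_contra hne
    have := hB ⟨c, ⟨x, hx, hne⟩, rfl⟩
    linarith
  exact hle hw

/-- The coefficients of a product of vertex operators vanish if the sum of the modes is
sufficiently negative. -/
lemma GRMod.exists_applyList_eq_zero {A : GRVA V} (M : GRMod V W A) {n : ℕ} (v : Fin n → V)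
    {w' : W →ₗ[ℂ] ℂ} (hw' : GradedFunctionalC M.grading w') (w : W) (L : List (Fin n)) :
    ∃ C : ℤ, ∀ k : Fin n → ℤ, (L.map k).sum ≤ C → w' (applyList M.Y v k L w) = 0 := by
  have hmem : ∃ d : ℝ, ∀ k : Fin n → ℤ,
      applyList M.Y v k L w ∈ M.weightGE (d - ((L.map k).sum : ℤ)) := by
    induction L with
    | nil =>
      obtain ⟨d, hd⟩ := M.exists_mem_weightGE
      exact ⟨d, fun k => M.weightGE_antitone (by simp) (hd w)⟩
    | cons t L ih =>
      obtain ⟨d, hd⟩ := ih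
      obtain ⟨e, he⟩ := M.exists_Y_mem_weightGE (v t)
      refine ⟨d + e, fun k => M.weightGE_antitone ?_ (he _ (k t) _ (hd k))⟩
      simp
      linarith
  obtain ⟨d, hd⟩ := hmem
  obtain ⟨r, hr⟩ := M.exists_eq_zero_of_mem_weightGE hw'
  refine ⟨⌊d - r⌋, fun k hk => hr _ (M.weightGE_antitone ?_ (hd k))⟩
  have : (((L.map k).sum : ℤ) : ℝ) ≤ d - r := Int.le_floor.mp hk
  linarith

/-! ## Iterated products of vertex operators -/

lemma applyList_append {X : Type} [AddCommGroup X] [Module ℂ X] {n : ℕ}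
    (Y : V →ₗ[ℂ] X →ₗ[ℂ] (ℤ → X)) (v : Fin n → V) (k : Fin n → ℤ) (L₁ L₂ : List (Fin n)) (w : X) :
    applyList Y v k (L₁ ++ L₂) w = applyList Y v k L₁ (applyList Y v k L₂ w) := by
  induction L₁ with
  | nil => rfl
  | cons t L₁ ih => simp [applyList, ih]

lemma applyList_congr {X : Type} [AddCommGroup X] [Module ℂ X] {n : ℕ}
    (Y : V →ₗ[ℂ] X →ₗ[ℂ] (ℤ → X)) (v : Fin n → V) {k k' : Fin n → ℤ} {L : List (Fin n)}
    (h : ∀ t ∈ L, k t = k' t) (w : X) : applyList Y v k L w = applyList Y v k' L w := by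
  induction L with
  | nil => rfl
  | cons t L ih =>
    simp only [List.mem_cons, forall_eq_or_imp] at h
    simp only [applyList, ih h.2, h.1]

/-- `applyList` as a linear map. -/
def applyListLin {X : Type} [AddCommGroup X] [Module ℂ X] {n : ℕ}
    (Y : V →ₗ[ℂ] X →ₗ[ℂ] (ℤ → X)) (v : Fin n → V) (k : Fin n → ℤ) : List (Fin n) → X →ₗ[ℂ] X
  | [] => LinearMap.id
  | t :: L => LinearMap.proj (k t) ∘ₗ Y (v t) ∘ₗ applyListLin Y v k L

lemma applyListLin_apply {X : Type} [AddCommGroup X] [Module ℂ X] {n : ℕ}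
    (Y : V →ₗ[ℂ] X →ₗ[ℂ] (ℤ → X)) (v : Fin n → V) (k : Fin n → ℤ) (L : List (Fin n)) (w : X) :
    applyListLin Y v k L w = applyList Y v k L w := by
  induction L with
  | nil => rfl
  | cons t L ih => simp [applyListLin, applyList, ih]

lemma diffMode_pow_restrict {X : Type*} [AddCommGroup X] [Module ℂ X] {n : ℕ} {s t : Fin n}
    (hst : s ≠ t) (N : ℕ) (F : (Fin n → ℤ) → X) (k : Fin n → ℤ) :
    (diffMode 0 1 ^ N) (fun q : Fin 2 → ℤ =>
        F (Function.update (Function.update k s (q 0)) t (q 1)))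
      = fun q => (diffMode s t ^ N) F (Function.update (Function.update k s (q 0)) t (q 1)) := by
  induction N with
  | zero => simp
  | succ N ih =>
    funext q
    have h0 : Function.update (Function.update k s (q 0)) t (q 1) + Pi.single s 1
        = Function.update (Function.update k s (q 0 + 1)) t (q 1) := by
      funext r
      by_cases hr : r = t
      · subst hr
        simp [hst.symm]
      · by_cases hs : r = s
        · subst hs
          simp [hr]
        · simp [hr, hs]
    have h1 : Function.update (Function.update k s (q 0)) t (q 1) + Pi.single t 1
        = Function.update (Function.update k s (q 0)) t (q 1 + 1) := by
      funext r
      by_cases hr : r = t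
      · subst hr
        simp
      · simp [hr]
    rw [pow_succ' (diffMode 0 1) N, pow_succ' (diffMode s t) N, Module.End.mul_apply, ih]
    simp [Module.End.mul_apply, diffMode_apply, h0, h1]

/-- The coefficients of `⟨w', Y_W(v_{t₁}, z_{t₁}) ⋯ Y_W(v_{t_l}, z_{t_l})w⟩` where
`L = [t₁, …, t_l]`. -/
def GRMod.correlator {A : GRVA V} (M : GRMod V W A) {n : ℕ} (v : Fin n → V) (w : W)
    (w' : W →ₗ[ℂ] ℂ) (L : List (Fin n)) : (Fin n → ℤ) → ℂ :=
  fun k => w' (applyList M.Y v k L w)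

lemma GRMod.diffMode_pow_correlator_swap {A : GRVA V} (M : GRMod V W A) {n : ℕ} (v : Fin n → V)
    (w : W) (w' : W →ₗ[ℂ] ℂ) {s t : Fin n} {L₁ L₂ : List (Fin n)}
    (hL : (L₁ ++ s :: t :: L₂).Nodup) {N : ℕ}
    (hN : ∀ x : W, (diffMode 0 1 ^ N) (fun k : Fin 2 → ℤ =>
      M.Y (v s) (M.Y (v t) x (k 1)) (k 0) - M.Y (v t) (M.Y (v s) x (k 0)) (k 1)) = 0) :
    (diffMode s t ^ N) (M.correlator v w w' (L₁ ++ s :: t :: L₂)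
      - M.correlator v w w' (L₁ ++ t :: s :: L₂)) = 0 := by
  simp only [List.nodup_append, List.nodup_cons, List.mem_cons, not_or] at hL
  obtain ⟨-, ⟨⟨hst, hs2⟩, ht2, -⟩, h1⟩ := hL
  funext k
  have hk : Function.update (Function.update k s (k s)) t (k t) = k := by simp
  have h2 := congrFun (diffMode_pow_restrict hst N (M.correlator v w w' (L₁ ++ s :: t :: L₂)
      - M.correlator v w w' (L₁ ++ t :: s :: L₂)) k) ![k s, k t]
  simp only [Matrix.cons_val_zero, Matrix.cons_val_one, hk] at h2
  rw [← h2]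
  have hcongr : ∀ (q : Fin 2 → ℤ) (L : List (Fin n)), s ∉ L → t ∉ L → ∀ x : W,
      applyList M.Y v (Function.update (Function.update k s (q 0)) t (q 1)) L x
        = applyList M.Y v k L x := by
    intro q L hs ht x
    refine applyList_congr M.Y v (fun r hr => ?_) x
    rw [Function.update_of_ne (ne_of_mem_of_not_mem hr ht),
      Function.update_of_ne (ne_of_mem_of_not_mem hr hs)]
  have hs1 : s ∉ L₁ := fun h => h1 s h s (Or.inl rfl) rfl
  have ht1 : t ∉ L₁ := fun h => h1 t h t (Or.inr (Or.inl rfl)) rfl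
  have hφ : (fun q : Fin 2 → ℤ => (M.correlator v w w' (L₁ ++ s :: t :: L₂)
      - M.correlator v w w' (L₁ ++ t :: s :: L₂))
        (Function.update (Function.update k s (q 0)) t (q 1)))
      = fun q => (w' ∘ₗ applyListLin M.Y v k L₁)
        (M.Y (v s) (M.Y (v t) (applyList M.Y v k L₂ w) (q 1)) (q 0)
          - M.Y (v t) (M.Y (v s) (applyList M.Y v k L₂ w) (q 0)) (q 1)) := by
    funext q
    simp only [GRMod.correlator, Pi.sub_apply, applyList_append, applyList, hcongr q L₁ hs1 ht1,
      hcongr q L₂ hs2 ht2, LinearMap.comp_apply, applyListLin_apply, map_sub,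
      Function.update_self, Function.update_of_ne hst]
  rw [hφ, map_diffMode_pow, hN]
  simp

lemma GRMod.eventuallyZeroAlong_correlator {A : GRVA V} (M : GRMod V W A) {n : ℕ} (v : Fin n → V)
    (w : W) (w' : W →ₗ[ℂ] ℂ) {i j : Fin n} {L₁ L₂ : List (Fin n)} (hi : i ∉ j :: L₂)
    (hj : j ∉ L₂) : EventuallyZeroAlong i j (M.correlator v w w' (L₁ ++ j :: L₂)) := by
  intro k
  obtain ⟨K, hK⟩ := M.trunc (v j) (applyList M.Y v k L₂ w)
  simp only [List.mem_cons, not_or] at hi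
  refine ⟨(K - k j).toNat, fun m hm => ?_⟩
  have h1 : applyList M.Y v (k + Pi.single i (-(m : ℤ)) + Pi.single j (m : ℤ)) L₂ w
      = applyList M.Y v k L₂ w := by
    refine applyList_congr M.Y v (fun r hr => ?_) w
    have hri : r ≠ i := fun h => hi.2 (h ▸ hr)
    have hrj : r ≠ j := fun h => hj (h ▸ hr)
    simp [hri, hrj]
  simp only [GRMod.correlator, applyList_append, applyList, h1]
  rw [hK _ (by simp [Ne.symm hi.1]; omega), ← applyListLin_apply, map_zero,
    map_zero]

/-! ## Clearing the poles along all diagonals -/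

/-- Multiplication of a formal series `∑ F k z^{-k-1}` by `∏_{(i, j) ∈ ps} (z i - z j) ^ N`. -/
def diffProd {X : Type*} [AddCommGroup X] [Module ℂ X] {n : ℕ} (N : ℕ)
    (ps : List (Fin n × Fin n)) : Module.End ℂ ((Fin n → ℤ) → X) :=
  (ps.map fun p => diffMode p.1 p.2 ^ N).prod

lemma diffMode_pow_induction {X : Type*} [AddCommGroup X] [Module ℂ X] {n : ℕ}
    {P : ((Fin n → ℤ) → X) → Prop} (hP : ∀ s t F, P F → P (diffMode s t F)) (s t : Fin n) (N : ℕ)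
    {F : (Fin n → ℤ) → X} (hF : P F) : P ((diffMode s t ^ N) F) := by
  induction N with
  | zero => simpa using hF
  | succ N ih =>
    rw [pow_succ', Module.End.mul_apply]
    exact hP s t _ ih

lemma diffProd_induction {X : Type*} [AddCommGroup X] [Module ℂ X] {n : ℕ}
    {P : ((Fin n → ℤ) → X) → Prop} (hP : ∀ s t F, P F → P (diffMode s t F)) (N : ℕ)
    (ps : List (Fin n × Fin n)) {F : (Fin n → ℤ) → X} (hF : P F) : P (diffProd N ps F) := by
  induction ps with
  | nil => simpa [diffProd] using hF
  | cons p ps ih =>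
    simp only [diffProd, List.map_cons, List.prod_cons, Module.End.mul_apply]
    exact diffMode_pow_induction hP _ _ N ih

lemma diffMode_swap_pow {X : Type*} [AddCommGroup X] [Module ℂ X] {n : ℕ} (i j : Fin n) (N : ℕ)
    (F : (Fin n → ℤ) → X) : (diffMode j i ^ N) F = (-1 : ℂ) ^ N • (diffMode i j ^ N) F := by
  have h : (diffMode j i : Module.End ℂ ((Fin n → ℤ) → X)) = (-1 : ℂ) • diffMode i j := by
    rw [diffMode_swap i j]
    exact (neg_one_smul ℂ _).symm
  rw [h, smul_pow, LinearMap.smul_apply]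

lemma diffMode_pow_eq_zero_of_le {X : Type*} [AddCommGroup X] [Module ℂ X] {n : ℕ} {s t : Fin n}
    {N N' : ℕ} (h : N ≤ N') {F : (Fin n → ℤ) → X} (hF : (diffMode s t ^ N) F = 0) :
    (diffMode s t ^ N') F = 0 := by
  rw [← Nat.sub_add_cancel h, pow_add, Module.End.mul_apply, hF, map_zero]

lemma diffProd_eq_zero {X : Type*} [AddCommGroup X] [Module ℂ X] {n : ℕ} {N : ℕ}
    {ps : List (Fin n × Fin n)} {p : Fin n × Fin n} (hp : p ∈ ps) {F : (Fin n → ℤ) → X}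
    (hF : (diffMode p.1 p.2 ^ N) F = 0) : diffProd N ps F = 0 := by
  obtain ⟨l₁, l₂, rfl⟩ := List.append_of_mem hp
  have hc : Commute (diffMode p.1 p.2 ^ N : Module.End ℂ ((Fin n → ℤ) → X)) (diffProd N l₂) := by
    refine Commute.list_prod_right _ _ fun x hx => ?_
    obtain ⟨q, -, rfl⟩ := List.mem_map.mp hx
    exact (commute_diffMode _ _ _ _).pow_pow _ _
  have : (diffProd N (l₁ ++ p :: l₂) : Module.End ℂ ((Fin n → ℤ) → X))
      = diffProd N l₁ * (diffProd N l₂ * diffMode p.1 p.2 ^ N) := by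
    rw [← hc.eq]
    simp [diffProd]
  rw [this, Module.End.mul_apply, Module.End.mul_apply, hF, map_zero, map_zero]

/-- The pairs of indices `i < j`. -/
def ltPairs (n : ℕ) : List (Fin n × Fin n) :=
  (Finset.univ.filter fun p : Fin n × Fin n => p.1 < p.2).toList

lemma mem_ltPairs {n : ℕ} {p : Fin n × Fin n} : p ∈ ltPairs n ↔ p.1 < p.2 := by
  simp [ltPairs]

lemma prod_ltPairs {n : ℕ} (g : Fin n → Fin n → ℂ) :
    ((ltPairs n).map fun p => g p.1 p.2).prod
      = ∏ i : Fin n, ∏ j : Fin n, (if i < j then g i j else 1) := by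
  rw [ltPairs, Finset.prod_map_toList, Finset.prod_filter, Fintype.prod_prod_type]

lemma diffProd_ltPairs_eq_zero {X : Type*} [AddCommGroup X] [Module ℂ X] {n : ℕ} {N : ℕ}
    {s t : Fin n} (hst : s ≠ t) {F : (Fin n → ℤ) → X} (hF : (diffMode s t ^ N) F = 0) :
    diffProd N (ltPairs n) F = 0 := by
  rcases hst.lt_or_gt with h | h
  · exact diffProd_eq_zero (p := (s, t)) (mem_ltPairs.mpr h) hF
  · refine diffProd_eq_zero (p := (t, s)) (mem_ltPairs.mpr h) ?_
    rw [diffMode_swap_pow s t, hF, smul_zero]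

/-- After multiplication by `∏_{i < j} (z i - z j) ^ N`, the product of vertex operators does not
depend on their order. -/
lemma GRMod.diffProd_correlator_perm {A : GRVA V} (M : GRMod V W A) {n : ℕ} (v : Fin n → V)
    (w : W) (w' : W →ₗ[ℂ] ℂ) {N : ℕ}
    (hN : ∀ (s t : Fin n) (x : W), (diffMode 0 1 ^ N) (fun k : Fin 2 → ℤ =>
      M.Y (v s) (M.Y (v t) x (k 1)) (k 0) - M.Y (v t) (M.Y (v s) x (k 0)) (k 1)) = 0)
    {L L' : List (Fin n)} (h : L.Perm L') (hL : L.Nodup) :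
    diffProd N (ltPairs n) (M.correlator v w w' L)
      = diffProd N (ltPairs n) (M.correlator v w w' L') := by
  suffices h' : ∀ L₁ : List (Fin n), (L₁ ++ L).Nodup →
      diffProd N (ltPairs n) (M.correlator v w w' (L₁ ++ L))
        = diffProd N (ltPairs n) (M.correlator v w w' (L₁ ++ L')) from h' [] hL
  clear hL
  induction h with
  | nil => intro L₁ _; rfl
  | @cons t l l' _ ih =>
    intro L₁ h₁
    simpa using ih (L₁ ++ [t]) (by simpa using h₁)
  | swap s t l =>
    intro L₁ h₁
    have hst : t ≠ s := by
      simp only [List.nodup_append, List.nodup_cons, List.mem_cons, not_or] at h₁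
      exact h₁.2.1.1.1
    rw [← sub_eq_zero, ← map_sub]
    exact diffProd_ltPairs_eq_zero hst (M.diffMode_pow_correlator_swap v w w' h₁ (hN t s))
  | @trans l l' l'' hl _ ih₁ ih₂ =>
    intro L₁ h₁
    exact (ih₁ L₁ h₁).trans (ih₂ L₁ (((hl.append_left L₁).nodup_iff).mp h₁))

/-- Division by `∏_{(i, j) ∈ ps} (z i - z j) ^ N`. -/
lemma hasSum_of_hasSum_diffProd {n : ℕ} {z : Fin n → ℂ} (hz : ∀ t, z t ≠ 0) (N : ℕ)
    {F : (Fin n → ℤ) → ℂ} (hF : ∀ i j, ‖z j‖ < ‖z i‖ → EventuallyZeroAlong i j F)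
    {ps : List (Fin n × Fin n)} (hps : ∀ p ∈ ps, ‖z p.2‖ < ‖z p.1‖ ∨ ‖z p.1‖ < ‖z p.2‖) {S : ℂ}
    (h : HasSum (fun k => diffProd N ps F k * modeMonomial z k)
      ((ps.map fun p => (z p.1 - z p.2) ^ N).prod * S)) :
    HasSum (fun k => F k * modeMonomial z k) S := by
  induction ps generalizing S with
  | nil => simpa [diffProd] using h
  | cons p ps ih =>
    simp only [List.mem_cons, forall_eq_or_imp] at hps
    refine ih hps.2 ?_
    have hE : ∀ i j, ‖z j‖ < ‖z i‖ → EventuallyZeroAlong i j (diffProd N ps F) := fun i j hij =>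
      diffProd_induction (P := EventuallyZeroAlong i j) (fun s t F hF => hF.diffMode_apply s t)
        N ps (hF i j hij)
    simp only [diffProd, List.map_cons, List.prod_cons, Module.End.mul_apply, mul_assoc] at h
    rcases hps.1 with hp | hp
    · exact hasSum_of_hasSum_diffMode_pow hz hp N (hE _ _ hp) h
    · refine hasSum_of_hasSum_diffMode_pow hz hp N (hE _ _ hp) ?_
      have h2 := h.mul_left ((-1 : ℂ) ^ N)
      rw [← mul_assoc, ← neg_pow, neg_sub] at h2
      refine h2.congr_fun fun k => ?_
      rw [diffMode_swap_pow p.1 p.2, Pi.smul_apply, smul_eq_mul, mul_assoc]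
      rfl

/-! ## The rational function -/

lemma GRMod.diffProd_correlator_eq_zero_of_le {A : GRVA V} (M : GRMod V W A) {n : ℕ}
    (v : Fin n → V) (w : W) (w' : W →ₗ[ℂ] ℂ) {N : ℕ}
    (hN : ∀ (s t : Fin n) (x : W), (diffMode 0 1 ^ N) (fun k : Fin 2 → ℤ =>
      M.Y (v s) (M.Y (v t) x (k 1)) (k 0) - M.Y (v t) (M.Y (v s) x (k 0)) (k 1)) = 0)
    {K : ℤ} {t : Fin n} (hK : ∀ m : ℤ, K ≤ m → M.Y (v t) w m = 0) {k : Fin n → ℤ} (hk : K ≤ k t) :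
    diffProd N (ltPairs n) (M.correlator v w w' (List.finRange n)) k = 0 := by
  have hperm : (List.finRange n).Perm ((List.finRange n).erase t ++ [t]) :=
    (List.perm_cons_erase (List.mem_finRange t)).trans (List.perm_append_singleton _ _).symm
  rw [M.diffProd_correlator_perm v w w' hN hperm (List.nodup_finRange n)]
  refine diffProd_induction (P := fun F => ∀ k : Fin n → ℤ, K ≤ k t → F k = 0) ?_ N (ltPairs n)
    ?_ k hk
  · intro i j F hF k hk
    have h : ∀ r : Fin n, K ≤ (k + Pi.single r 1 : Fin n → ℤ) t := by
      intro r
      rw [Pi.add_apply, Pi.single_apply]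
      split_ifs <;> omega
    rw [diffMode_apply, hF _ (h i), hF _ (h j), sub_zero]
  · intro k hk
    simp only [GRMod.correlator, applyList_append, applyList, hK _ hk]
    rw [← applyListLin_apply, map_zero, map_zero]

lemma GRMod.exists_diffProd_correlator_eq_zero {A : GRVA V} (M : GRMod V W A) {n : ℕ}
    (v : Fin n → V) (w : W) {w' : W →ₗ[ℂ] ℂ} (hw' : GradedFunctionalC M.grading w') (N : ℕ)
    (ps : List (Fin n × Fin n)) :
    ∃ C : ℤ, ∀ k : Fin n → ℤ, ∑ t, k t ≤ C →
      diffProd N ps (M.correlator v w w' (List.finRange n)) k = 0 := by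
  refine diffProd_induction (P := fun F => ∃ C : ℤ, ∀ k : Fin n → ℤ, ∑ t, k t ≤ C → F k = 0)
    ?_ N ps ?_
  · rintro i j F ⟨C, hC⟩
    refine ⟨C - 1, fun k hk => ?_⟩
    have h : ∀ r : Fin n, ∑ t, (k + Pi.single r 1 : Fin n → ℤ) t ≤ C := by
      intro r
      simp only [Pi.add_apply, Finset.sum_add_distrib, Finset.sum_pi_single', Finset.mem_univ,
        if_true]
      omega
    rw [diffMode_apply, hC _ (h i), hC _ (h j), sub_zero]
  · obtain ⟨C, hC⟩ := M.exists_applyList_eq_zero v hw' w (List.finRange n)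
    refine ⟨C, fun k hk => hC k ?_⟩
    rwa [← Fin.sum_univ_def]

lemma finite_support_of_bounds {n : ℕ} {G : (Fin n → ℤ) → ℂ} {K C : ℤ}
    (hK : ∀ (t : Fin n) (k : Fin n → ℤ), K ≤ k t → G k = 0)
    (hC : ∀ k : Fin n → ℤ, ∑ t, k t ≤ C → G k = 0) : (Function.support G).Finite := by
  refine (Set.finite_Icc (fun _ : Fin n => K - (n * K - C)) (fun _ => K)).subset fun k hk => ?_
  have h1 : ∀ t, k t < K := fun t => not_le.mp fun h => hk (hK t k h)
  have h2 : C < ∑ t, k t := not_le.mp fun h => hk (hC k h)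
  refine ⟨fun t => ?_, fun t => (h1 t).le⟩
  have h3 := Finset.single_le_sum (f := fun r => K - k r) (fun r _ => sub_nonneg.mpr (h1 r).le)
    (Finset.mem_univ t)
  simp only [Finset.sum_sub_distrib, Finset.sum_const, Finset.card_univ, Fintype.card_fin,
    nsmul_eq_mul] at h3
  change K - (n * K - C) ≤ k t
  linarith

lemma ratFull_sum_div {n N : ℕ} {G : (Fin n → ℤ) → ℂ} {s : Finset (Fin n → ℤ)}
    (hs : ∀ k ∈ s, ∀ t, k t < N) :
    RatFull n (fun z => (∑ k ∈ s, G k * modeMonomial z k) /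
      ∏ i : Fin n, ∏ j : Fin n, (if i < j then (z i - z j) ^ N else 1)) := by
  refine ⟨∑ k ∈ s, MvPolynomial.C (G k) * ∏ t, MvPolynomial.X t ^ (N - k t - 1).toNat, N,
    fun z hz hne => ?_⟩
  have hD : ∏ i : Fin n, ∏ j : Fin n, (if i < j then (z i - z j) ^ N else 1) ≠ 0 := by
    refine Finset.prod_ne_zero_iff.mpr fun i _ => Finset.prod_ne_zero_iff.mpr fun j _ => ?_
    split_ifs with h
    · exact pow_ne_zero _ (sub_ne_zero.mpr (hne i j h.ne))
    · exact one_ne_zero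
  rw [mul_comm (∏ i : Fin n, z i ^ N), ← mul_assoc, div_mul_cancel₀ _ hD, Finset.sum_mul, map_sum]
  refine Finset.sum_congr rfl fun k hk => ?_
  simp only [map_mul, map_prod, map_pow, MvPolynomial.eval_C, MvPolynomial.eval_X, modeMonomial]
  rw [mul_assoc, ← Finset.prod_mul_distrib]
  refine congrArg _ (Finset.prod_congr rfl fun t _ => ?_)
  have := hs k hk t
  rw [← zpow_natCast, ← zpow_natCast, ← zpow_add₀ (hz t), Int.toNat_of_nonneg (by omega)]
  congr 1
  ring

lemma GRMod.exists_uniform_bounds {A : GRVA V} (M : GRMod V W A) {n : ℕ} (v : Fin n → V) (w : W) :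
    ∃ N : ℕ, (∀ (s t : Fin n) (x : W), (diffMode 0 1 ^ N) (fun k : Fin 2 → ℤ =>
      M.Y (v s) (M.Y (v t) x (k 1)) (k 0) - M.Y (v t) (M.Y (v s) x (k 0)) (k 1)) = 0) ∧
      ∀ (t : Fin n) (m : ℤ), (N : ℤ) ≤ m → M.Y (v t) w m = 0 := by
  choose c hc using fun s t => weak_commutativity M (v s) (v t)
  choose K hK using fun t => M.trunc (v t) w
  refine ⟨(Finset.univ.sup fun s => Finset.univ.sup (c s)) + Finset.univ.sup fun t => (K t).toNat,
    fun s t x => diffMode_pow_eq_zero_of_le ?_ (hc s t x), fun t m hm => hK t m ?_⟩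
  · have h1 := Finset.le_sup (f := c s) (Finset.mem_univ t)
    have h2 := Finset.le_sup (f := fun s => Finset.univ.sup (c s)) (Finset.mem_univ s)
    exact (h1.trans h2).trans (Nat.le_add_right _ _)
  · have h1 := Finset.le_sup (f := fun t => (K t).toNat) (Finset.mem_univ t)
    push_cast at hm
    omega

/-- Proposition 2.4: for `v₁,…,vₙ ∈ V`, `w ∈ W`, `w' ∈ W'`, the
series `⟨w', Y_W(v₁,z₁) ⋯ Y_W(vₙ,zₙ)w⟩` converges absolutely in the region
`|z₁| > ⋯ > |zₙ| > 0` to a rational function with only possible poles at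
`z i = z j` (`i ≠ j`) and `z i = 0`, and for every `σ ∈ Sₙ` the series for the
reordered product `⟨w', Y_W(v_{σ(1)},z_{σ(1)}) ⋯ Y_W(v_{σ(n)},z_{σ(n)})w⟩`
converges in the region `|z_{σ(1)}| > ⋯ > |z_{σ(n)}| > 0` to the *same* rational
function of `(z₁,…,zₙ)`. -/
theorem n_point_convergence_and_commutativity
    (A : GRVA V) (M : GRMod V W A) (n : ℕ) (v : Fin n → V) (w : W)
    (w' : W →ₗ[ℂ] ℂ) (hw' : GradedFunctionalC M.grading w') :
    ∃ f : (Fin n → ℂ) → ℂ, RatFull n f ∧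
      ∀ (σ : Equiv.Perm (Fin n)) (z : Fin n → ℂ),
        (List.ofFn (fun t => σ t)).Chain' (fun s t => ‖z s‖ > ‖z t‖) →
        (∀ t, z t ≠ 0) →
        HasSum (fun k : Fin n → ℤ =>
          w' (applyList M.Y v k (List.ofFn (fun t => σ t)) w) *
            ∏ t, z t ^ (-(k t) - 1)) (f z) := by
  obtain ⟨N, hcomm, htrunc⟩ := M.exists_uniform_bounds v w
  set G := diffProd N (ltPairs n) (M.correlator v w w' (List.finRange n)) with hG
  obtain ⟨C, hC⟩ := M.exists_diffProd_correlator_eq_zero v w hw' N (ltPairs n)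
  have hup : ∀ (t : Fin n) (k : Fin n → ℤ), (N : ℤ) ≤ k t → G k = 0 := fun t k hk =>
    M.diffProd_correlator_eq_zero_of_le v w w' hcomm (htrunc t) hk
  have hfin : (Function.support G).Finite := finite_support_of_bounds hup hC
  refine ⟨_, ratFull_sum_div (N := N) (G := G) (s := hfin.toFinset) fun k hk t =>
    not_le.mp fun h => hfin.mem_toFinset.mp hk (hup t k h), fun σ z hchain hz => ?_⟩
  have : IsTrans (Fin n) (fun s t => ‖z s‖ > ‖z t‖) := ⟨fun _ _ _ h₁ h₂ => lt_trans h₂ h₁⟩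
  have hpw : (List.ofFn fun t => σ t).Pairwise fun s t => ‖z s‖ > ‖z t‖ :=
    List.isChain_iff_pairwise.mp hchain
  have hmem : ∀ t, t ∈ List.ofFn fun t => σ t := fun t =>
    List.mem_ofFn.mpr (σ.surjective t)
  have hnodup : (List.ofFn fun t => σ t).Nodup := List.nodup_ofFn.mpr σ.injective
  have hperm : (List.ofFn fun t => σ t).Perm (List.finRange n) :=
    (List.perm_ext_iff_of_nodup hnodup (List.nodup_finRange n)).mpr fun t =>
      iff_of_true (hmem t) (List.mem_finRange t)
  have hlt : ∀ s t : Fin n, s ≠ t → ‖z t‖ < ‖z s‖ ∨ ‖z s‖ < ‖z t‖ := by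
    intro s t hst
    have hsymm : Std.Symm fun s t : Fin n => ‖z t‖ < ‖z s‖ ∨ ‖z s‖ < ‖z t‖ := ⟨fun _ _ => Or.symm⟩
    have hor : (List.ofFn fun t => σ t).Pairwise
        fun s t => ‖z t‖ < ‖z s‖ ∨ ‖z s‖ < ‖z t‖ := hpw.imp fun h => Or.inl h
    exact hor.forall (hmem s) (hmem t) hst
  have hE : ∀ i j, ‖z j‖ < ‖z i‖ →
      EventuallyZeroAlong i j (M.correlator v w w' (List.ofFn fun t => σ t)) := by
    intro i j hij
    obtain ⟨L₁, L₂, hL⟩ := List.append_of_mem (hmem j)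
    rw [hL] at hpw hnodup ⊢
    have h1 := List.pairwise_cons.mp (List.pairwise_append.mp hpw).2.1
    refine M.eventuallyZeroAlong_correlator v w w' ?_
      (List.nodup_cons.mp (List.nodup_append.mp hnodup).2.1).1
    rw [List.mem_cons, not_or]
    exact ⟨fun h => hij.ne (by rw [h]), fun h => lt_asymm hij (h1.1 i h)⟩
  refine hasSum_of_hasSum_diffProd hz N hE
    (fun p hp => hlt p.1 p.2 (mem_ltPairs.mp hp).ne) ?_
  rw [M.diffProd_correlator_perm v w w' hcomm hperm hnodup,
    prod_ltPairs fun i j => (z i - z j) ^ N, mul_div_cancel₀]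
  · refine hasSum_sum_of_ne_finset_zero fun k hk => ?_
    rw [hfin.mem_toFinset, Function.notMem_support] at hk
    rw [← hG, hk, zero_mul]
  · refine Finset.prod_ne_zero_iff.mpr fun i _ => Finset.prod_ne_zero_iff.mpr fun j _ => ?_
    split_ifs with h
    · refine pow_ne_zero _ (sub_ne_zero.mpr fun he => ?_)
      have := hlt i j h.ne
      simp [he] at this
    · exact one_ne_zero
end VertexCohomology
end

section
/- Let Φ : V^{⊗n} → W̃_{z₁,…,zₙ} be a linear map having the L(−1)-derivative property. Then: (1) for v₁,…,vₙ ∈ V, w′ ∈ W′, (z₁,…,zₙ) ∈ F_nℂ and z ∈ ℂ with (z₁+z,…,zₙ+z) ∈ F_nℂ, ⟨w′, e^{zL_W(−1)} (Φ(v₁⊗⋯⊗vₙ))(z₁,…,zₙ)⟩ = ⟨w′, (Φ(v₁⊗⋯⊗vₙ))(z₁+z,…,zₙ+z)⟩; and (2) for 1 ≤ i ≤ n and z ∈ ℂ such that (z₁,…,z_{i−1}, zᵢ+z, z_{i+1},…,zₙ) ∈ F_nℂ, the power series expansion in z of ⟨w′, (Φ(v₁⊗⋯⊗vₙ))(z₁,…,zᵢ+z,…,zₙ)⟩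 equals the power series ⟨w′, (Φ(v₁⊗⋯⊗v_{i−1}⊗ e^{zL_V(−1)}vᵢ ⊗ v_{i+1}⊗⋯⊗vₙ))(z₁,…,zₙ)⟩; in particular the latter converges absolutely to the former in the disk |z| < min_{i≠j} |zᵢ − zⱼ|. -/
open scoped BigOperators Classical

noncomputable section VertexCohomology

/-! ## Grading-restricted vertex algebras and modules -/

variable (V : Type) [AddCommGroup V] [Module ℂ V]
variable (W : Type) [AddCommGroup W] [Module ℂ W]

variable {V W}

/-! ## Taylor expansion along a chain of derivatives -/

/-- If each `G m` has derivative `G (m + 1)` on a ball, then the values of the `G m` at the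
center are the Taylor coefficients of `G 0`. -/
lemma hasSum_taylor_of_hasDerivAt_succ {G : ℕ → ℂ → ℂ} {c : ℂ} {r : ℝ}
    (hG : ∀ m, ∀ t ∈ Metric.ball c r, HasDerivAt (G m) (G (m + 1) t) t)
    {t : ℂ} (ht : t ∈ Metric.ball c r) :
    HasSum (fun m : ℕ => ((t - c) ^ m * (m.factorial : ℂ)⁻¹) * G m c) (G 0 t) := by
  have hc : c ∈ Metric.ball c r := Metric.mem_ball_self (Metric.pos_of_mem_ball ht)
  have hiter : ∀ m, Set.EqOn (iteratedDeriv m (G 0)) (G m) (Metric.ball c r) := by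
    intro m
    induction m with
    | zero => intro s _; simp
    | succ m ih =>
      intro s hs
      rw [iteratedDeriv_succ, Filter.EventuallyEq.deriv_eq (f := G m), (hG m s hs).deriv]
      filter_upwards [Metric.isOpen_ball.mem_nhds hs] with x hx using ih hx
  have hdiff : DifferentiableOn ℂ (G 0) (Metric.ball c r) := fun s hs =>
    (hG 0 s hs).differentiableAt.differentiableWithinAt
  refine (Complex.hasSum_taylorSeries_on_ball hdiff ht).congr_fun fun m => ?_
  rw [hiter m hc, smul_eq_mul, smul_eq_mul]
  ring

/-! ## Differentiability of rational functions on the configuration space -/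

lemma isOpen_pairwise_ne (n : ℕ) :
    IsOpen {z : Fin n → ℂ | ∀ s t, s ≠ t → z s ≠ z t} := by
  simp only [Set.ofPred_forall]
  refine isOpen_iInter_of_finite fun s => isOpen_iInter_of_finite fun t =>
    isOpen_iInter_of_finite fun _ => ?_
  exact isOpen_ne_fun (continuous_apply s) (continuous_apply t)

lemma RatDiag.differentiableAt {n : ℕ} {f : (Fin n → ℂ) → ℂ} (hf : RatDiag n f)
    {z : Fin n → ℂ} (hz : ∀ s t, s ≠ t → z s ≠ z t) : DifferentiableAt ℂ f z := by
  obtain ⟨P, N, hP⟩ := hf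
  let D : (Fin n → ℂ) → ℂ := fun z =>
    ∏ i : Fin n, ∏ j : Fin n, (if i < j then (z i - z j) ^ N else 1)
  have hD : Differentiable ℂ D := by
    have hcont : ContDiff ℂ 1 D := by
      refine contDiff_prod fun i _ => contDiff_prod fun j _ => ?_
      split_ifs <;> fun_prop
    exact hcont.differentiable one_ne_zero
  have hD0 : ∀ y : Fin n → ℂ, (∀ s t, s ≠ t → y s ≠ y t) → D y ≠ 0 := by
    intro y hy
    refine Finset.prod_ne_zero_iff.2 fun i _ => Finset.prod_ne_zero_iff.2 fun j _ => ?_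
    split_ifs with h
    · exact pow_ne_zero _ (sub_ne_zero.2 (hy i j h.ne))
    · exact one_ne_zero
  have hE : DifferentiableAt ℂ (fun y => MvPolynomial.eval y P) z :=
    (AnalyticOnNhd.eval_mvPolynomial (𝕜 := ℂ) P z trivial).differentiableAt
  refine (hE.fun_mul (hD.differentiableAt.inv (hD0 z hz))).congr_of_eventuallyEq ?_
  filter_upwards [(isOpen_pairwise_ne n).mem_nhds hz] with y hy
  exact (eq_mul_inv_iff_mul_eq₀ (hD0 y hy)).2 (hP y hy)

/-- The derivative of a function along the diagonal direction is the sum of its partial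
derivatives. -/
lemma hasDerivAt_diagonal_of_partial {n : ℕ} {f : (Fin n → ℂ) → ℂ} {p : Fin n → ℂ}
    {z : Fin n → ℂ} {t : ℂ} (hf : DifferentiableAt ℂ f (fun i => z i + t))
    (hp : ∀ i, HasDerivAt (fun s => f (Function.update (fun i => z i + t) i s)) (p i) (z i + t)) :
    HasDerivAt (fun s => f (fun i => z i + s)) (∑ i, p i) t := by
  have hdiag : HasDerivAt (fun s : ℂ => fun i => z i + s) (fun _ : Fin n => (1 : ℂ)) t :=
    hasDerivAt_pi.2 fun i => (hasDerivAt_id t).const_add (z i)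
  have hpart : ∀ i, p i = fderiv ℂ f (fun i => z i + t) (Pi.single i 1) := by
    intro i
    refine (hp i).unique ?_
    have hfi : HasFDerivAt f (fderiv ℂ f (fun i => z i + t))
        (Function.update (fun i => z i + t) i (z i + t)) := by
      have : Function.update (fun i => z i + t) i (z i + t) = fun i => z i + t :=
        Function.update_eq_self i _
      rw [this]
      exact hf.hasFDerivAt
    exact hfi.comp_hasDerivAt (z i + t) (hasDerivAt_update (fun i => z i + t) i (z i + t))
  refine (hf.hasFDerivAt.comp_hasDerivAt t hdiag).congr_deriv ?_
  rw [Finset.sum_congr rfl fun i _ => hpart i, ← map_sum]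
  congr 1
  exact (Finset.univ_sum_single fun _ : Fin n => (1 : ℂ)).symm

/-! ## Pairings with powers of `L_W(-1)` -/

lemma GradedFunctionalC.comp_Lm1_pow {A : GRVA V} {M : GRMod V W A} {w' : W →ₗ[ℂ] ℂ}
    (hw' : GradedFunctionalC M.grading w') (m : ℕ) :
    GradedFunctionalC M.grading (w' ∘ₗ M.Lm1 ^ m) := by
  refine (hw'.preimage (f := fun c : ℂ => c + m) (add_left_injective _).injOn).subset ?_
  rintro c ⟨w, hw, hne⟩
  exact ⟨_, Lm1_pow_mem M m c w hw, hne⟩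

lemma pairBar_comp_Lm1_pow {A : GRVA V} {M : GRMod V W A} (w' : W →ₗ[ℂ] ℂ) (m : ℕ)
    (ω : WbarT M) :
    pairBar (w' ∘ₗ M.Lm1 ^ m) ω = ∑ᶠ c : ℂ, w' ((M.Lm1 ^ m) (ω (c - m) : W)) :=
  (finsum_comp_equiv (Equiv.subRight (m : ℂ))
    (f := fun c : ℂ => w' ((M.Lm1 ^ m) (ω c : W)))).symm

lemma pairBar_Lm1bar {A : GRVA V} {M : GRMod V W A} (w' : W →ₗ[ℂ] ℂ) (ω : WbarT M) :
    pairBar w' (Lm1bar M ω) = pairBar (w' ∘ₗ M.Lm1) ω := by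
  have h := pairBar_comp_Lm1_pow w' 1 ω
  rw [pow_one, Nat.cast_one] at h
  exact h.symm

/-- Pairing with `e^{ζ L_W(-1)} ω` is the exponential series of the pairings with
`L_W(-1)^m ω`, all but finitely many of which vanish. -/
lemma hasSum_pairBar_expLm1 {A : GRVA V} {M : GRMod V W A} {w' : W →ₗ[ℂ] ℂ}
    (hw' : GradedFunctionalC M.grading w') (ζ : ℂ) (ω : WbarT M) :
    HasSum (fun m : ℕ => (ζ ^ m * (m.factorial : ℂ)⁻¹) * pairBar (w' ∘ₗ M.Lm1 ^ m) ω)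
      (pairBar w' (expLm1 M ζ ω)) := by
  obtain ⟨N, hN⟩ := M.lower_trunc
  obtain ⟨R, hR⟩ := (hw'.image Complex.re).bddAbove
  obtain ⟨K, hK⟩ := exists_nat_gt (R - N)
  let S : Finset ℂ := hw'.toFinset
  have hzero : ∀ c ∉ S, ∀ w ∈ M.grading c, w' w = 0 := by
    intro c hc w hw
    by_contra hne
    exact hc (hw'.mem_toFinset.2 ⟨w, hw, hne⟩)
  have hlow : ∀ c ∈ S, ∀ m : ℕ, K ≤ m → (ω (c - m) : W) = 0 := by
    intro c hc m hm
    have hcR : c.re ≤ R := hR ⟨c, hw'.mem_toFinset.1 hc, rfl⟩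
    have hKm : (K : ℝ) ≤ m := Nat.cast_le.2 hm
    have hbot : M.grading (c - m) = ⊥ := hN _ (by simp; linarith)
    exact (Submodule.mem_bot ℂ).1 (hbot ▸ (ω (c - m)).2)
  have hshift : ∀ (c : ℂ) (m : ℕ), (M.Lm1 ^ m) (ω (c - m) : W) ∈ M.grading c := by
    intro c m
    simpa using Lm1_pow_mem M m (c - m) _ (ω (c - m)).2
  have hpair : ∀ m : ℕ, pairBar (w' ∘ₗ M.Lm1 ^ m) ω
      = ∑ c ∈ S, w' ((M.Lm1 ^ m) (ω (c - m) : W)) := by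
    intro m
    rw [pairBar_comp_Lm1_pow]
    refine finsum_eq_sum_of_support_subset _ fun c hc => ?_
    by_contra hcS
    exact hc (hzero c hcS _ (hshift c m))
  have hexp : pairBar w' (expLm1 M ζ ω)
      = ∑ m ∈ Finset.range K, (ζ ^ m * (m.factorial : ℂ)⁻¹) * pairBar (w' ∘ₗ M.Lm1 ^ m) ω := by
    have hsub : pairBar w' (expLm1 M ζ ω) = ∑ c ∈ S, w' (expLm1 M ζ ω c : W) := by
      refine finsum_eq_sum_of_support_subset _ fun c hc => ?_
      by_contra hcS
      exact hc (hzero c hcS _ (expLm1 M ζ ω c).2)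
    simp_rw [hsub, hpair, Finset.mul_sum]
    rw [Finset.sum_comm]
    refine Finset.sum_congr rfl fun c hc => ?_
    have hcomp : expLm1 M ζ ω c = ∑ m ∈ Finset.range K,
        (ζ ^ m * (m.factorial : ℂ)⁻¹) •
          (⟨(M.Lm1 ^ m) (ω (c - m) : W), hshift c m⟩ : M.grading c) := by
      refine finsum_eq_sum_of_support_subset _ fun m hm => ?_
      by_contra hmK
      refine hm ?_
      have h0 := hlow c hc m (by simpa using hmK)
      ext
      simp [h0]
    rw [hcomp]
    simp
  rw [hexp]
  refine hasSum_sum_of_ne_finset_zero fun m hm => ?_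
  rw [hpair, Finset.sum_eq_zero, mul_zero]
  intro c hc
  rw [hlow c hc m (by simpa using hm), map_zero, map_zero]

/-! ## Derivatives of cochains with the `L(-1)`-derivative property -/

lemma HasL1D.hasDerivAt_update {A : GRVA V} {M : GRMod V W A} {n : ℕ} {Φ : Cochain M n}
    (hL : HasL1D Φ) (v : Fin n → V) {w' : W →ₗ[ℂ] ℂ} (hw' : GradedFunctionalC M.grading w')
    (i : Fin n) (z : Fin n → ℂ) (m : ℕ) {t : ℂ}
    (hz : ∀ j k, j ≠ k → Function.update z i t j ≠ Function.update z i t k) :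
    HasDerivAt
      (fun s => pairBar w' (Φ (Function.update v i ((A.Lm1 ^ m) (v i))) (Function.update z i s)))
      (pairBar w' (Φ (Function.update v i ((A.Lm1 ^ (m + 1)) (v i))) (Function.update z i t)))
      t := by
  have h := hL.1 (Function.update v i ((A.Lm1 ^ m) (v i))) w' hw' i (Function.update z i t) hz
  simp only [Function.update_idem, Function.update_self] at h
  rw [pow_succ']
  exact h

lemma HasL1D.hasDerivAt_diagonal {A : GRVA V} {M : GRMod V W A} {n : ℕ} {Φ : Cochain M n}
    (hL : HasL1D Φ) (hrat : TakesRatValues Φ) (v : Fin n → V) {w' : W →ₗ[ℂ] ℂ}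
    (hw' : GradedFunctionalC M.grading w') {z : Fin n → ℂ} (hz : ∀ s t, s ≠ t → z s ≠ z t)
    (t : ℂ) :
    HasDerivAt (fun s => pairBar w' (Φ v (fun i => z i + s)))
      (pairBar (w' ∘ₗ M.Lm1) (Φ v (fun i => z i + t))) t := by
  have hzt : ∀ j k, j ≠ k → z j + t ≠ z k + t := fun j k hjk h =>
    hz j k hjk (add_right_cancel h)
  rw [← pairBar_Lm1bar, ← hL.2 v w' hw' _ hzt]
  exact hasDerivAt_diagonal_of_partial ((hrat v w' hw').differentiableAt hzt)
    fun i => hL.1 v w' hw' i _ hzt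

lemma update_pairwise_ne {n : ℕ} {z : Fin n → ℂ} (hz : ∀ s t, s ≠ t → z s ≠ z t)
    {i : Fin n} {u : ℂ} (hu : ∀ j, j ≠ i → u ≠ z j) :
    ∀ j k, j ≠ k → Function.update z i u j ≠ Function.update z i u k := by
  intro j k hjk
  rcases eq_or_ne j i with rfl | hj
  · rw [Function.update_self, Function.update_of_ne hjk.symm]
    exact hu k hjk.symm
  rcases eq_or_ne k i with rfl | hk
  · rw [Function.update_self, Function.update_of_ne hj]
    exact (hu j hj).symm
  · rw [Function.update_of_ne hj, Function.update_of_ne hk]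
    exact hz j k hjk

/-- consequences of the `L(-1)`-derivative property for a linear
map `Φ : V^{⊗n} → W̃_{z₁,…,zₙ}`: (1) `⟨w', e^{ζ L_W(-1)}(Φ(v₁⊗⋯⊗vₙ))(z₁,…,zₙ)⟩ =
⟨w', (Φ(v₁⊗⋯⊗vₙ))(z₁+ζ,…,zₙ+ζ)⟩`; (2) the power series
`∑_m (ζ^m/m!) ⟨w', (Φ(v₁⊗⋯⊗ L_V(-1)^m vᵢ ⊗⋯⊗vₙ))(z₁,…,zₙ)⟩` (i.e. the expansion
of `Φ` with `e^{ζL_V(-1)}vᵢ` inserted) converges absolutely to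
`⟨w', (Φ(v₁⊗⋯⊗vₙ))(z₁,…,zᵢ+ζ,…,zₙ)⟩` in the disk `|ζ| < min_{s≠t}|z_s - z_t|`. -/
theorem L1D_exponential_shift
    (A : GRVA V) (M : GRMod V W A) (n : ℕ)
    (Φ : Cochain M n) (hrat : TakesRatValues Φ) (hL : HasL1D Φ)
    (v : Fin n → V) (w' : W →ₗ[ℂ] ℂ) (hw' : GradedFunctionalC M.grading w')
    (zs : Fin n → ℂ) (hdist : ∀ s t, s ≠ t → zs s ≠ zs t) :
    (∀ ζ : ℂ, (∀ s t, s ≠ t → zs s + ζ ≠ zs t + ζ) →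
      pairBar w' (expLm1 M ζ (Φ v zs)) = pairBar w' (Φ v (fun i => zs i + ζ))) ∧
    (∀ (i : Fin n) (ζ : ℂ), (∀ s t : Fin n, s ≠ t → ‖ζ‖ < ‖zs s - zs t‖) →
      HasSum (fun m : ℕ =>
        (ζ ^ m * ((m.factorial : ℂ))⁻¹) *
          pairBar w' (Φ (Function.update v i ((A.Lm1 ^ m) (v i))) zs))
        (pairBar w' (Φ v (Function.update zs i (zs i + ζ))))) := by
  refine ⟨fun ζ _ => ?_, fun i ζ hζ => ?_⟩
  · have htaylor := hasSum_taylor_of_hasDerivAt_succ (c := 0) (r := ‖ζ‖ + 1) (t := ζ)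
      (G := fun m t => pairBar (w' ∘ₗ M.Lm1 ^ m) (Φ v (fun i => zs i + t)))
      (fun m t _ => by
        rw [pow_succ]
        exact hL.hasDerivAt_diagonal hrat v (hw'.comp_Lm1_pow m) hdist t)
      (by simp)
    simp only [sub_zero, add_zero] at htaylor
    exact (hasSum_pairBar_expLm1 hw' ζ (Φ v zs)).unique htaylor
  · obtain ⟨r, hr, hζr⟩ : ∃ r, (∀ s t : Fin n, s ≠ t → r < ‖zs s - zs t‖) ∧ ‖ζ‖ < r := by
      have hev : ∀ᶠ r in nhdsWithin ‖ζ‖ (Set.Ioi ‖ζ‖),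
          ∀ s t : Fin n, s ≠ t → r < ‖zs s - zs t‖ := by
        refine Filter.eventually_all.2 fun s => Filter.eventually_all.2 fun t =>
          Filter.eventually_all.2 fun hst => ?_
        exact nhdsWithin_le_nhds (eventually_lt_nhds (hζ s t hst))
      exact (hev.and self_mem_nhdsWithin).exists
    have htaylor := hasSum_taylor_of_hasDerivAt_succ (c := zs i) (r := r) (t := zs i + ζ)
      (G := fun m t => pairBar w'
        (Φ (Function.update v i ((A.Lm1 ^ m) (v i))) (Function.update zs i t)))
      (fun m t ht => hL.hasDerivAt_update v hw' i zs m
        (update_pairwise_ne hdist fun j hj htj => by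
          rw [htj, mem_ball_iff_norm] at ht
          exact (hr j i hj).not_gt ht))
      (by simpa [mem_ball_iff_norm] using hζr)
    simpa using htaylor
end VertexCohomology
end
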